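/- Let (q,r,α) be an admissible triple. Then there exists a constant C > 0 such that for every Schwartz function F on ℝ_t × ℝ_x, ‖∫_ℝ D^{(α/2)(1−2/r)} e^{-it'∂_x⁴} F(t',·) dt'‖_{L²(ℝ)} ≤ C ‖F‖_{L_t^{q'} L_x^{r'}(ℝ×ℝ)}, where 1/q + 1/q' = 1 and 1/r + 1/r' = 1. -/

import Mathlib

open MeasureTheory Complex
open scoped ENNReal

/-- The Fourier transform `û(ξ) = ∫ e^{-ixξ} u(x) dx`. -/
noncomputable def fourierInt (u : ℝ → ℂ) (ξ : ℝ) : ℂ :=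
  ∫ x : ℝ, Complex.exp (-(Complex.I * x * ξ)) * u x

/-- `(D^β e^{it∂_x⁴} u)(x) = (2π)⁻¹ ∫ |ξ|^β e^{i(xξ+tξ⁴)} û(ξ) dξ`. -/
noncomputable def DbihamGroup (β t : ℝ) (u : ℝ → ℂ) (x : ℝ) : ℂ :=
  (2 * Real.pi)⁻¹ * ∫ ξ : ℝ, ((|ξ| ^ β : ℝ) : ℂ) *
    Complex.exp (Complex.I * (x * ξ + t * ξ^4)) * fourierInt u ξ

/-- `(q,r,α)` is an admissible triple. -/
def Admissible (q r : ℝ≥0∞) (α : ℝ) : Prop :=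
  α ∈ Set.Icc (0:ℝ) 1 ∧ 2 ≤ r ∧ ENNReal.ofReal (8 / (1 + α)) ≤ q ∧
    4 / q + ENNReal.ofReal (1 + α) / r = ENNReal.ofReal ((1 + α) / 2)

/-- The mixed space-time norm `‖F‖_{L_t^q L_x^r}`. -/
noncomputable def mixedNorm (q r : ℝ≥0∞) (F : ℝ → ℝ → ℂ) : ℝ≥0∞ :=
  eLpNorm (fun t => (eLpNorm (F t) r volume).toReal) q volume

section Strichartz

open FourierTransform SchwartzMap

section Plancherel

open scoped ContDiff

/-- Plancherel's identity for the Fourier integral of an `L¹ ∩ L²` function. -/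
lemma eLpNorm_fourier_eq {f : ℝ → ℂ} (h1 : Integrable f) (h2 : MemLp f 2) :
    eLpNorm (𝓕 f) 2 volume = eLpNorm f 2 volume := by
  set f2 : Lp ℂ 2 (volume : Measure ℝ) := h2.toLp f with hf2
  have hcont : Continuous (𝓕 f) :=
    VectorFourier.fourierIntegral_continuous Real.continuous_fourierChar continuous_inner h1
  have hae : ∀ᵐ x, (𝓕 f2 : Lp ℂ 2 (volume : Measure ℝ)) x = 𝓕 f x := by
    refine ae_eq_of_integral_contDiff_smul_eq ((Lp.memLp _).locallyIntegrable (by norm_num))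
      hcont.locallyIntegrable fun g g_smooth g_cpt => ?_
    have hg₁ : HasCompactSupport (Complex.ofRealCLM ∘ g) := g_cpt.comp_left rfl
    have hg₂ : ContDiff ℝ ∞ (Complex.ofRealCLM ∘ g) := by fun_prop
    set φ : 𝓢(ℝ, ℂ) := hg₁.toSchwartzMap hg₂ with hφ
    have e1 := congrArg (fun T => T φ) (Lp.fourier_toTemperedDistribution_eq f2)
    simp only [TemperedDistribution.fourier_apply, Lp.toTemperedDistribution_apply] at e1
    have e2 : ∫ x, (𝓕 φ) x • f2 x = ∫ x, (𝓕 φ) x • f x := by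
      refine integral_congr_ae ?_
      filter_upwards [h2.coeFn_toLp] with x hx
      rw [hf2, hx]
    have e3 : ∫ x, (𝓕 (φ : ℝ → ℂ)) x • f x = ∫ x, φ x • 𝓕 f x := by
      simpa using! (VectorFourier.integral_fourierIntegral_smul_eq_flip (L := innerₗ ℝ)
        Real.continuous_fourierChar continuous_inner φ.integrable h1)
    calc _ = ∫ x, φ x • (𝓕 f2 : Lp ℂ 2 (volume : Measure ℝ)) x := by simp [hφ]
      _ = ∫ x, φ x • 𝓕 f x := by rw [← e1, e2, ← e3, SchwartzMap.fourier_coe]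
      _ = _ := by simp [hφ]
  rw [← eLpNorm_congr_ae hae]
  have := Lp.norm_fourier_eq f2
  rw [Lp.norm_def, Lp.norm_def, ENNReal.toReal_eq_toReal_iff' (Lp.eLpNorm_ne_top _)
    (Lp.eLpNorm_ne_top _)] at this
  rw [this, hf2, eLpNorm_congr_ae h2.coeFn_toLp]

lemma fourierInt_eq (u : ℝ → ℂ) (ξ : ℝ) : fourierInt u ξ = 𝓕 u ((2 * Real.pi)⁻¹ * ξ) := by
  rw [Real.fourier_real_eq_integral_exp_smul]
  refine integral_congr_ae (.of_forall fun x => ?_)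
  have : (Real.pi : ℂ) ≠ 0 := by exact_mod_cast Real.pi_ne_zero
  simp only [smul_eq_mul]
  congr 2
  push_cast
  field_simp

lemma lintegral_enorm_sq_eq (u : ℝ → ℂ) : ∫⁻ x, ‖u x‖ₑ ^ 2 = eLpNorm u 2 volume ^ 2 := by
  rw [eLpNorm_eq_lintegral_rpow_enorm_toReal (by norm_num) (by norm_num), ← ENNReal.rpow_natCast,
    ← ENNReal.rpow_mul]
  simp

lemma lintegral_enorm_fourierInt_sq {u : ℝ → ℂ} (h1 : Integrable u) (h2 : MemLp u 2) :
    ∫⁻ ξ, ‖fourierInt u ξ‖ₑ ^ 2 = ENNReal.ofReal (2 * Real.pi) * ∫⁻ x, ‖u x‖ₑ ^ 2 := by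
  have hcont : Continuous (𝓕 u) :=
    VectorFourier.fourierIntegral_continuous Real.continuous_fourierChar continuous_inner h1
  simp_rw [fourierInt_eq]
  have h0 : ((2 * Real.pi)⁻¹ : ℝ) ≠ 0 := by positivity
  have key := lintegral_map (μ := volume) (f := fun y => ‖𝓕 u y‖ₑ ^ 2)
    (g := fun ξ => (2 * Real.pi)⁻¹ * ξ) (by fun_prop) (by fun_prop)
  rw [← key, Real.map_volume_mul_left h0, lintegral_smul_measure, lintegral_enorm_sq_eq,
    eLpNorm_fourier_eq h1 h2, lintegral_enorm_sq_eq, inv_inv, abs_of_pos (by positivity)]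
  rfl

end Plancherel

section HardyLittlewoodSobolev

lemma lintegral_Ioo_rpow {a : ℝ} (ha : -1 < a) {R : ℝ} (hR : 0 ≤ R) :
    ∫⁻ u in Set.Ioo 0 R, ENNReal.ofReal (u ^ a) = ENNReal.ofReal (R ^ (a + 1) / (a + 1)) := by
  have hi : IntervalIntegrable (fun u : ℝ => u ^ a) volume 0 R :=
    intervalIntegral.intervalIntegrable_rpow' ha
  rw [← ofReal_integral_eq_lintegral_ofReal, ← integral_Ioc_eq_integral_Ioo,
    ← intervalIntegral.integral_of_le hR, integral_rpow (Or.inl ha), Real.zero_rpow (by linarith),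
    sub_zero]
  · exact ((intervalIntegrable_iff_integrableOn_Ioc_of_le hR).1 hi).mono_set Set.Ioo_subset_Ioc_self
  · filter_upwards [ae_restrict_mem measurableSet_Ioo] with u hu
    exact Real.rpow_nonneg hu.1.le _

lemma lintegral_ball_abs_rpow_le {a : ℝ} (ha : -1 < a) {R : ℝ} (hR : 0 ≤ R) (t : ℝ) :
    ∫⁻ s in {s | |t - s| < R}, ENNReal.ofReal (|t - s| ^ a) ≤
      ENNReal.ofReal (2 / (a + 1) * R ^ (a + 1)) := by
  have hm : MeasurableSet {s : ℝ | |t - s| < R} := measurableSet_lt (by fun_prop) (by fun_prop)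
  set G : ℝ → ℝ≥0∞ := (Set.Ioo 0 R).indicator fun u => ENNReal.ofReal (u ^ a) with hG
  have hGm : Measurable G := Measurable.indicator (by fun_prop) measurableSet_Ioo
  have hGi : ∫⁻ u, G u = ENNReal.ofReal (R ^ (a + 1) / (a + 1)) := by
    rw [hG, lintegral_indicator measurableSet_Ioo, lintegral_Ioo_rpow ha hR]
  rw [← lintegral_indicator hm]
  calc _ ≤ ∫⁻ s, (G (t - s) + G (s - t)) := by
        refine lintegral_mono_ae ?_
        filter_upwards [Measure.ae_ne volume t] with s hs
        by_cases h : |t - s| < R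
        · rw [Set.indicator_of_mem (by exact h)]
          rcases lt_or_gt_of_ne hs with h1 | h1
          · refine le_trans (le_of_eq ?_) le_self_add
            rw [abs_of_pos (by linarith)] at h ⊢
            rw [hG, Set.indicator_of_mem (Set.mem_Ioo.2 ⟨by linarith, h⟩)]
          · refine le_trans (le_of_eq ?_) le_add_self
            rw [abs_of_neg (by linarith), neg_sub] at h ⊢
            rw [hG, Set.indicator_of_mem (Set.mem_Ioo.2 ⟨by linarith, h⟩)]
        · rw [Set.indicator_of_notMem (by exact h)]; exact zero_le
    _ = _ := by
      rw [lintegral_add_left (by fun_prop), lintegral_sub_left_eq_self G t,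
        lintegral_sub_right_eq_self G t, hGi, ← ENNReal.ofReal_add]
      · congr 1; ring
      all_goals exact div_nonneg (Real.rpow_nonneg hR _) (by linarith)

lemma lintegral_abs_rpow_neg_le {l : ℝ} (hl0 : 0 < l) (hl1 : l < 1) (t : ℝ) (E : Set ℝ) :
    ∫⁻ s in E, ENNReal.ofReal (|t - s| ^ (-l)) ≤
      ENNReal.ofReal (2 / (1 - l) + 1) * volume E ^ (1 - l) := by
  have hK : (0 : ℝ) < 2 / (1 - l) + 1 := by
    have : 0 < 1 - l := by linarith
    positivity
  rcases eq_or_ne (volume E) ⊤ with h | h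
  · rw [h, ENNReal.top_rpow_of_pos (by linarith), ENNReal.mul_top (by simpa using hK)]
    exact le_top
  rcases eq_or_ne (volume E) 0 with h0 | h0
  · rw [Measure.restrict_eq_zero.2 h0]; simp
  set R := (volume E).toReal with hRdef
  have hR : 0 < R := ENNReal.toReal_pos h0 h
  have hvol : volume E = ENNReal.ofReal R := (ENNReal.ofReal_toReal h).symm
  have hm : MeasurableSet {s : ℝ | |t - s| < R} := measurableSet_lt (by fun_prop) (by fun_prop)
  calc _ ≤ ∫⁻ s in E, ({s : ℝ | |t - s| < R}.indicator
            (fun s => ENNReal.ofReal (|t - s| ^ (-l))) s + ENNReal.ofReal (R ^ (-l))) := by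
        refine lintegral_mono fun s => ?_
        by_cases hs : |t - s| < R
        · rw [Set.indicator_of_mem (by exact hs)]; exact le_self_add
        · rw [Set.indicator_of_notMem (by exact hs), zero_add]
          refine ENNReal.ofReal_le_ofReal ?_
          exact Real.rpow_le_rpow_of_nonpos hR (not_lt.1 hs) (by linarith)
    _ ≤ ENNReal.ofReal (2 / (1 - l) * R ^ (1 - l)) +
          ENNReal.ofReal (R ^ (-l)) * ENNReal.ofReal R := by
        rw [lintegral_add_right _ measurable_const, setLIntegral_const, hvol]
        gcongr
        refine (setLIntegral_le_lintegral _ _).trans ?_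
        rw [lintegral_indicator hm]
        have := lintegral_ball_abs_rpow_le (a := -l) (by linarith) hR.le t
        rwa [show -l + 1 = 1 - l by ring] at this
    _ = _ := by
        have h1 : 0 < 1 - l := by linarith
        rw [hvol, ENNReal.ofReal_rpow_of_pos hR, ← ENNReal.ofReal_mul (by positivity),
          ← ENNReal.ofReal_mul (by positivity), ← ENNReal.ofReal_add (by positivity)
          (by positivity)]
        congr 1
        have : R ^ (-l) * R = R ^ (1 - l) := by
          rw [show 1 - l = -l + 1 by ring, Real.rpow_add_one hR.ne']
        rw [this]; ring

/-- The part of the Riesz potential of `h` coming from the points where `h ≤ c`. -/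
lemma lintegral_le_level_mul_abs_rpow_neg_le {l : ℝ} (hl0 : 0 < l) (hl1 : l < 1) {h : ℝ → ℝ}
    (hm : Measurable h) (h0 : ∀ t, 0 ≤ h t) (t : ℝ) {c : ℝ} (hc : 0 ≤ c) :
    ∫⁻ s in {s | h s ≤ c}, ENNReal.ofReal (h s) * ENNReal.ofReal (|t - s| ^ (-l)) ≤
      ENNReal.ofReal ((2 / (1 - l) + 1) * (2 - l) / l) *
        (∫⁻ s, ENNReal.ofReal (h s) ^ (2 / (2 - l))) ^ (1 - l) *
          ENNReal.ofReal (c ^ (l / (2 - l))) := by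
  set p := 2 / (2 - l) with hp
  have h2l : 0 < 2 - l := by linarith
  have h1l : 0 < 1 - l := by linarith
  have hp0 : 0 < p := by positivity
  set H := ∫⁻ s, ENNReal.ofReal (h s) ^ p with hH
  set A := {s | h s ≤ c} with hA
  have hAm : MeasurableSet A := measurableSet_le hm measurable_const
  set k : ℝ → ℝ≥0∞ := fun s => ENNReal.ofReal (|t - s| ^ (-l)) with hk
  have hkm : Measurable k := by fun_prop
  set K := ENNReal.ofReal (2 / (1 - l) + 1) with hK
  set e := p * (1 - l) with he
  have he1 : -1 < -e := by
    rw [he, hp, neg_lt_neg_iff, div_mul_eq_mul_div, div_lt_one h2l]; linarith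
  have hee : -e + 1 = l / (2 - l) := by rw [he, hp]; field_simp; ring
  have hset : ∀ b : ℝ, MeasurableSet {s | b < h s} := fun b => measurableSet_lt measurable_const hm
  calc _ = ∫⁻ s, ENNReal.ofReal (h s) ∂((volume.restrict A).withDensity k) := by
        rw [lintegral_withDensity_eq_lintegral_mul _ hkm (by fun_prop)]
        refine lintegral_congr fun s => ?_
        simp [mul_comm, hk]
    _ = ∫⁻ b in Set.Ioi 0, ((volume.restrict A).withDensity k) {s | b < h s} :=
        lintegral_eq_lintegral_meas_lt _ (.of_forall h0) hm.aemeasurable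
    _ ≤ ∫⁻ b in Set.Ioi 0, (Set.Ioo 0 c).indicator
          (fun b => K * H ^ (1 - l) * ENNReal.ofReal (b ^ (-e))) b := by
        refine setLIntegral_mono' measurableSet_Ioi fun b hb => ?_
        have hb : 0 < b := hb
        rw [withDensity_apply _ (hset b), Measure.restrict_restrict (hset b)]
        by_cases hbc : b < c
        · rw [Set.indicator_of_mem (Set.mem_Ioo.2 ⟨hb, hbc⟩)]
          have cheb : volume {s | b < h s} ≤ H * ENNReal.ofReal (b ^ (-p)) := by
            have h1 : ENNReal.ofReal (b ^ p) * volume {s | b < h s} ≤ H := by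
              refine le_trans ?_ (mul_meas_ge_le_lintegral (f := fun s => ENNReal.ofReal (h s) ^ p)
                (by fun_prop) (ENNReal.ofReal (b ^ p)))
              gcongr
              intro hs
              rw [← ENNReal.ofReal_rpow_of_pos hb]
              gcongr
            calc volume {s | b < h s}
                = ENNReal.ofReal (b ^ p) * volume {s | b < h s} * ENNReal.ofReal (b ^ (-p)) := by
                  rw [mul_right_comm, ← ENNReal.ofReal_mul (by positivity), ← Real.rpow_add hb]
                  simp
              _ ≤ _ := by gcongr
          calc _ ≤ ∫⁻ s in {s | b < h s}, k s := lintegral_mono_set Set.inter_subset_left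
            _ ≤ K * volume {s | b < h s} ^ (1 - l) := lintegral_abs_rpow_neg_le hl0 hl1 t _
            _ ≤ K * (H * ENNReal.ofReal (b ^ (-p))) ^ (1 - l) := by gcongr
            _ = _ := by
              rw [ENNReal.mul_rpow_of_nonneg _ _ h1l.le, ENNReal.ofReal_rpow_of_pos (by positivity),
                ← Real.rpow_mul hb.le, ← mul_assoc, he, neg_mul]
        · have : {s | b < h s} ∩ A = ∅ := by
            ext s
            simp only [hA, Set.mem_inter_iff, Set.mem_ofPred_eq, Set.mem_empty_iff_false, iff_false,
              not_and, not_le]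
            intro h1
            linarith
          rw [this]
          simp
    _ ≤ K * H ^ (1 - l) * ∫⁻ b in Set.Ioo 0 c, ENNReal.ofReal (b ^ (-e)) := by
        refine (setLIntegral_le_lintegral _ _).trans ?_
        rw [lintegral_indicator measurableSet_Ioo, lintegral_const_mul _ (by fun_prop)]
    _ = _ := by
        rw [lintegral_Ioo_rpow he1 hc, hee, hK, mul_right_comm,
          ← ENNReal.ofReal_mul (by positivity),
          mul_right_comm, ← ENNReal.ofReal_mul (by positivity)]
        congr 2
        field_simp

/-- The diagonal Hardy-Littlewood-Sobolev inequality on the line. -/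
lemma lintegral_lintegral_mul_abs_rpow_neg_le {l : ℝ} (hl0 : 0 < l) (hl1 : l < 1) {h : ℝ → ℝ}
    (hm : Measurable h) (h0 : ∀ t, 0 ≤ h t) :
    ∫⁻ t, ∫⁻ s, ENNReal.ofReal (h t) * ENNReal.ofReal (h s) * ENNReal.ofReal (|t - s| ^ (-l)) ≤
      ENNReal.ofReal (2 * ((2 / (1 - l) + 1) * (2 - l) / l)) *
        (∫⁻ s, ENNReal.ofReal (h s) ^ (2 / (2 - l))) ^ (2 - l) := by
  have h2l : 0 < 2 - l := by linarith
  have h1l : 0 < 1 - l := by linarith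
  set H := ∫⁻ s, ENNReal.ofReal (h s) ^ (2 / (2 - l)) with hH
  set f : ℝ → ℝ → ℝ≥0∞ := fun t s =>
    {x : ℝ × ℝ | h x.2 ≤ h x.1}.indicator (fun x => ENNReal.ofReal (h x.1) *
      ENNReal.ofReal (h x.2) * ENNReal.ofReal (|x.1 - x.2| ^ (-l))) (t, s) with hf
  have hfm : Measurable (Function.uncurry f) :=
    Measurable.indicator (by fun_prop)
      (measurableSet_le (hm.comp measurable_snd) (hm.comp measurable_fst))
  set Q := (2 / (1 - l) + 1) * (2 - l) / l with hQ
  have hmain : ∫⁻ t, ∫⁻ s, f t s ≤ ENNReal.ofReal Q * H ^ (2 - l) := by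
    calc _ ≤ ∫⁻ t, ENNReal.ofReal Q * H ^ (1 - l) * ENNReal.ofReal (h t) ^ (2 / (2 - l)) := by
          refine lintegral_mono fun t => ?_
          have hA : MeasurableSet {s | h s ≤ h t} := measurableSet_le hm measurable_const
          have e1 : ∫⁻ s, f t s = ENNReal.ofReal (h t) * ∫⁻ s in {s | h s ≤ h t},
              ENNReal.ofReal (h s) * ENNReal.ofReal (|t - s| ^ (-l)) := by
            rw [← lintegral_const_mul _ (by fun_prop), ← lintegral_indicator hA]
            refine lintegral_congr fun s => ?_
            by_cases hs : h s ≤ h t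
            · rw [Set.indicator_of_mem (by exact hs), hf]
              simp [hs, mul_assoc]
            · rw [Set.indicator_of_notMem (by exact hs), hf]
              simp [hs]
          rw [e1]
          calc _ ≤ ENNReal.ofReal (h t) *
                  (ENNReal.ofReal Q * H ^ (1 - l) * ENNReal.ofReal (h t ^ (l / (2 - l)))) := by
                gcongr
                exact lintegral_le_level_mul_abs_rpow_neg_le hl0 hl1 hm h0 t (h0 t)
            _ = _ := by
                rw [← ENNReal.ofReal_rpow_of_nonneg (h0 t) (by positivity)]
                rw [mul_left_comm]
                congr 1
                conv_lhs => rw [← ENNReal.rpow_one (ENNReal.ofReal (h t))]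
                rw [← ENNReal.rpow_mul, ← ENNReal.rpow_add_of_nonneg _ _ (by positivity)
                  (by positivity)]
                congr 1
                field_simp
                ring
      _ = _ := by
          rw [lintegral_const_mul _ (by fun_prop), mul_assoc]
          congr 1
          conv_lhs => rw [← hH, ← ENNReal.rpow_one H]
          rw [← ENNReal.rpow_mul, ← ENNReal.rpow_add_of_nonneg _ _ (by positivity) (by positivity)]
          congr 1
          ring
  calc _ ≤ ∫⁻ t, ∫⁻ s, (f t s + f s t) := by
        refine lintegral_mono fun t => lintegral_mono fun s => ?_
        rcases le_total (h s) (h t) with hs | hs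
        · refine le_trans (le_of_eq ?_) le_self_add
          simp [hf, hs]
        · refine le_trans (le_of_eq ?_) le_add_self
          simp [hf, hs, abs_sub_comm t s, mul_comm]
    _ = (∫⁻ t, ∫⁻ s, f t s) + ∫⁻ t, ∫⁻ s, f s t := by
        rw [← lintegral_add_left (f := fun t => ∫⁻ s, f t s) hfm.lintegral_prod_right']
        refine lintegral_congr fun t => ?_
        rw [lintegral_add_left]
        exact hfm.comp measurable_prodMk_left
    _ = (∫⁻ t, ∫⁻ s, f t s) + ∫⁻ t, ∫⁻ s, f t s := by
        congr 1
        exact lintegral_lintegral_swap (hfm.comp measurable_swap).aemeasurable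
    _ ≤ _ := by
        rw [← two_mul, ENNReal.ofReal_mul zero_le_two, mul_assoc]
        simpa using by gcongr

end HardyLittlewoodSobolev

section OscillatoryIntegral

/-- The amplitude `ξ ^ (a + i b)`. -/
noncomputable def powAmp (a b ξ : ℝ) : ℂ := cexp ((a + b * I) * Real.log ξ)

/-- The quartic oscillation `e^{i(xξ + ξ⁴)}`. -/
noncomputable def quarticOsc (x ξ : ℝ) : ℂ := cexp (I * (x * ξ + ξ ^ 4))

lemma norm_powAmp (a b : ℝ) {ξ : ℝ} (hξ : 0 < ξ) : ‖powAmp a b ξ‖ = ξ ^ a := by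
  rw [powAmp, Complex.norm_exp, Real.rpow_def_of_pos hξ]
  simp [mul_comm]

lemma norm_quarticOsc (x ξ : ℝ) : ‖quarticOsc x ξ‖ = 1 := by
  rw [quarticOsc, mul_comm, show (x * ξ + ξ ^ 4 : ℂ) = ((x * ξ + ξ ^ 4 : ℝ) : ℂ) by push_cast; rfl]
  exact Complex.norm_exp_ofReal_mul_I _

lemma hasDerivAt_powAmp (a b : ℝ) {ξ : ℝ} (hξ : 0 < ξ) :
    HasDerivAt (powAmp a b) ((a + b * I) / ξ * powAmp a b ξ) ξ := by
  have h := (((Real.hasDerivAt_log hξ.ne').ofReal_comp).const_mul (a + b * I : ℂ)).cexp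
  refine h.congr_deriv ?_
  rw [powAmp]
  push_cast
  ring

lemma hasDerivAt_quarticOsc (x ξ : ℝ) :
    HasDerivAt (quarticOsc x) (I * (x + 4 * ξ ^ 3) * quarticOsc x ξ) ξ := by
  have h0 : HasDerivAt (fun ξ : ℝ => x * ξ + ξ ^ 4) (x + 4 * ξ ^ 3) ξ := by
    refine (((hasDerivAt_id ξ).const_mul x).add (hasDerivAt_pow 4 ξ)).congr_deriv ?_
    simp
  have h := (h0.ofReal_comp.const_mul I).cexp
  have e : quarticOsc x = fun ξ : ℝ => cexp (I * ((x * ξ + ξ ^ 4 : ℝ) : ℂ)) := by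
    ext ξ; rw [quarticOsc]; push_cast; rfl
  rw [e]
  refine h.congr_deriv ?_
  push_cast
  ring

lemma continuousOn_powAmp (a b : ℝ) : ContinuousOn (powAmp a b) (Set.Ioi 0) :=
  fun _ hξ => (hasDerivAt_powAmp a b hξ).continuousAt.continuousWithinAt

lemma continuous_quarticOsc (x : ℝ) : Continuous (quarticOsc x) :=
  continuous_iff_continuousAt.2 fun ξ => (hasDerivAt_quarticOsc x ξ).continuousAt

lemma intervalIntegrable_powAmp_mul_quarticOsc (a b x : ℝ) {u v : ℝ} (hu : 0 < u) (huv : u ≤ v) :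
    IntervalIntegrable (fun ξ => powAmp a b ξ * quarticOsc x ξ) volume u v := by
  refine (((continuousOn_powAmp a b).mul (continuous_quarticOsc x).continuousOn).mono
    fun ξ hξ => ?_).intervalIntegrable
  rw [Set.uIcc_of_le huv] at hξ
  exact hu.trans_le hξ.1

/-- Non-stationary phase estimate for the quartic phase. -/
lemma norm_integral_powAmp_mul_quarticOsc_le_of_nonstationary {a : ℝ} (ha0 : 0 ≤ a) (ha1 : a ≤ 1)
    (b x : ℝ) {m u v : ℝ} (hm : 1 ≤ m) (hu : 1 ≤ u) (huv : u ≤ v)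
    (hdist : ∀ ξ ∈ Set.Icc u v, 1 ≤ m * |ξ - m|)
    (hphase : ∀ ξ ∈ Set.Icc u v, 3 * |ξ - m| * ξ ^ 2 ≤ |x + 4 * ξ ^ 3|) :
    ‖∫ ξ in u..v, powAmp a b ξ * quarticOsc x ξ‖ ≤ 14 * (1 + |b|) := by
  have huIcc : Set.uIcc u v = Set.Icc u v := Set.uIcc_of_le huv
  have hd : ∀ ξ ∈ Set.Icc u v, 0 < |ξ - m| := fun ξ hξ => by
    by_contra h
    have h2 := hdist ξ hξ
    have : |ξ - m| = 0 := le_antisymm (not_lt.1 h) (abs_nonneg _)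
    rw [this] at h2
    linarith
  have hξ1 : ∀ ξ ∈ Set.Icc u v, 1 ≤ ξ := fun ξ hξ => hu.trans hξ.1
  have hφ : ∀ ξ ∈ Set.Icc u v, 0 < |x + 4 * ξ ^ 3| := fun ξ hξ => by
    have := hd ξ hξ
    have := hξ1 ξ hξ
    exact lt_of_lt_of_le (by positivity) (hphase ξ hξ)
  have hφc : ∀ ξ ∈ Set.Icc u v, (I * (x + 4 * ξ ^ 3) : ℂ) ≠ 0 := fun ξ hξ => by
    have h : (x + 4 * ξ ^ 3 : ℂ) = ((x + 4 * ξ ^ 3 : ℝ) : ℂ) := by push_cast; rfl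
    rw [h]
    exact mul_ne_zero I_ne_zero (by exact_mod_cast abs_pos.1 (hφ ξ hξ))
  set w : ℝ → ℂ := fun ξ => powAmp a b ξ / (I * (x + 4 * ξ ^ 3)) with hw
  set w' : ℝ → ℂ := fun ξ => ((a + b * I) / ξ * powAmp a b ξ * (I * (x + 4 * ξ ^ 3)) -
    powAmp a b ξ * (I * (12 * ξ ^ 2))) / (I * (x + 4 * ξ ^ 3)) ^ 2 with hw'
  have hden : ∀ ξ : ℝ,
      HasDerivAt (fun ξ : ℝ => (I * (x + 4 * ξ ^ 3) : ℂ)) (I * (12 * ξ ^ 2)) ξ := by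
    intro ξ
    have h0 : HasDerivAt (fun ξ : ℝ => x + 4 * ξ ^ 3) (12 * ξ ^ 2) ξ := by
      refine (((hasDerivAt_pow 3 ξ).const_mul 4).const_add x).congr_deriv ?_
      push_cast; ring
    have := h0.ofReal_comp.const_mul I
    push_cast at this
    exact this
  have hwd : ∀ ξ ∈ Set.Icc u v, HasDerivAt w (w' ξ) ξ := fun ξ hξ =>
    (hasDerivAt_powAmp a b (by linarith [hξ1 ξ hξ])).div (hden ξ) (hφc ξ hξ)
  have hpc : ContinuousOn (powAmp a b) (Set.Icc u v) :=
    (continuousOn_powAmp a b).mono fun ξ hξ => by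
      have := hξ1 ξ hξ
      exact Set.mem_Ioi.2 (by linarith)
  have hw'c : ContinuousOn w' (Set.Icc u v) := by
    refine ContinuousOn.div ?_ (by fun_prop) fun ξ hξ => pow_ne_zero 2 (hφc ξ hξ)
    refine ContinuousOn.sub (ContinuousOn.mul (ContinuousOn.mul ?_ hpc) (by fun_prop))
      (hpc.mul (by fun_prop))
    refine ContinuousOn.div (by fun_prop) (by fun_prop) fun ξ hξ => ?_
    have := hξ1 ξ hξ
    exact_mod_cast (by linarith : (0 : ℝ) < ξ).ne'
  have hibp := intervalIntegral.integral_mul_deriv_eq_deriv_mul (a := u) (b := v) (u := w)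
    (v := quarticOsc x) (u' := w') (v' := fun ξ => I * (x + 4 * ξ ^ 3) * quarticOsc x ξ)
    (fun ξ hξ => hwd ξ (huIcc ▸ hξ)) (fun ξ _ => hasDerivAt_quarticOsc x ξ)
    (hw'c.mono huIcc.le).intervalIntegrable
    (((continuous_quarticOsc x).const_mul 1 |>.mul (by fun_prop : Continuous
      fun ξ : ℝ => (I * (x + 4 * ξ ^ 3) : ℂ))).intervalIntegrable u v |>.congr (by
        intro ξ _; simp [mul_comm]))
  have hlhs : ∫ ξ in u..v, powAmp a b ξ * quarticOsc x ξ =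
      ∫ ξ in u..v, w ξ * (I * (x + 4 * ξ ^ 3) * quarticOsc x ξ) := by
    refine intervalIntegral.integral_congr fun ξ hξ => ?_
    have := hφc ξ (huIcc ▸ hξ)
    simp only [hw]
    rw [← mul_assoc, div_mul_cancel₀ _ this]
  have hprod : ∀ ξ ∈ Set.Icc u v, 1 / 2 ≤ |ξ - m| * ξ := fun ξ hξ => by
    have h1 := hdist ξ hξ
    have h2 := hξ1 ξ hξ
    rcases le_total (m / 2) ξ with h | h
    · nlinarith [hd ξ hξ]
    · have : m / 2 ≤ |ξ - m| := by
        rw [abs_sub_comm]; exact le_trans (by linarith) (le_abs_self _)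
      nlinarith
  have hpow : ∀ ξ ∈ Set.Icc u v, ξ ^ a ≤ ξ := fun ξ hξ => by
    simpa using Real.rpow_le_rpow_of_exponent_le (hξ1 ξ hξ) ha1
  have hnφ : ∀ ξ : ℝ, ‖(I * (x + 4 * ξ ^ 3) : ℂ)‖ = |x + 4 * ξ ^ 3| := fun ξ => by
    have h : (x + 4 * ξ ^ 3 : ℂ) = ((x + 4 * ξ ^ 3 : ℝ) : ℂ) := by push_cast; rfl
    rw [norm_mul, Complex.norm_I, one_mul, h, Complex.norm_real, Real.norm_eq_abs]
  have hwb : ∀ ξ ∈ Set.Icc u v, ‖w ξ‖ ≤ 2 / 3 := fun ξ hξ => by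
    have h1 := hξ1 ξ hξ
    have h0 : 0 < ξ := by linarith
    rw [hw, norm_div, hnφ, norm_powAmp _ _ h0, div_le_iff₀ (hφ ξ hξ)]
    nlinarith [hpow ξ hξ, hphase ξ hξ, hprod ξ hξ]
  set B' : ℝ → ℝ := fun ξ => 4 * (1 + |b|) * (m⁻¹ * ((ξ - m) ^ 2)⁻¹ + (ξ ^ 2)⁻¹) with hB'
  set B : ℝ → ℝ := fun ξ => 4 * (1 + |b|) * (m⁻¹ * -(ξ - m)⁻¹ + -ξ⁻¹) with hB
  have hsub : ∀ ξ ∈ Set.Icc u v, ξ - m ≠ 0 := fun ξ hξ => abs_pos.1 (hd ξ hξ)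
  have hBd : ∀ ξ ∈ Set.Icc u v, HasDerivAt B (B' ξ) ξ := fun ξ hξ => by
    have h1 := hξ1 ξ hξ
    have h0 : ξ ≠ 0 := by linarith
    have := ((((((hasDerivAt_id ξ).sub_const m).inv (hsub ξ hξ)).neg).const_mul m⁻¹).add
      ((hasDerivAt_inv h0).neg)).const_mul (4 * (1 + |b|))
    refine this.congr_deriv ?_
    simp [hB', neg_div]
  have hw'b : ∀ ξ ∈ Set.Icc u v, ‖w' ξ * quarticOsc x ξ‖ ≤ B' ξ := fun ξ hξ => by
    have h1 := hξ1 ξ hξ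
    have h0 : 0 < ξ := by linarith
    have hdξ := hd ξ hξ
    have hφξ := hφ ξ hξ
    have hph := hphase ξ hξ
    rw [norm_mul, norm_quarticOsc, mul_one]
    simp only [hw']
    rw [norm_div, norm_pow, hnφ]
    have hab : ‖(a + b * I : ℂ)‖ ≤ 1 + |b| := by
      refine (norm_add_le _ _).trans ?_
      simp [abs_of_nonneg ha0, ha1]
    have hnum : ‖(a + b * I) / ξ * powAmp a b ξ * (I * (x + 4 * ξ ^ 3)) -
        powAmp a b ξ * (I * (12 * ξ ^ 2))‖ ≤ (1 + |b|) * |x + 4 * ξ ^ 3| + ξ * (12 * ξ ^ 2) := by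
      refine (norm_sub_le _ _).trans (add_le_add ?_ ?_)
      · rw [norm_mul, norm_mul, norm_div, hnφ, norm_powAmp _ _ h0, Complex.norm_real,
          Real.norm_of_nonneg h0.le]
        gcongr
        rw [div_mul_eq_mul_div, div_le_iff₀ h0]
        have := hpow ξ hξ
        gcongr
      · rw [norm_mul, norm_powAmp _ _ h0]
        gcongr
        · exact hpow ξ hξ
        · simp
    set d := |ξ - m| with hdd
    have hd2 : (ξ - m) ^ 2 = d ^ 2 := (sq_abs _).symm
    have hD : 0 < 3 * d * ξ ^ 2 := by positivity
    calc _ ≤ ((1 + |b|) * |x + 4 * ξ ^ 3| + ξ * (12 * ξ ^ 2)) / |x + 4 * ξ ^ 3| ^ 2 := by gcongr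
      _ = (1 + |b|) / |x + 4 * ξ ^ 3| + 12 * ξ ^ 3 / |x + 4 * ξ ^ 3| ^ 2 := by
        field_simp
      _ ≤ (1 + |b|) / (3 * d * ξ ^ 2) + 12 * ξ ^ 3 / (3 * d * ξ ^ 2) ^ 2 := by gcongr
      _ = (1 + |b|) * (1 / 3 * (d * ξ ^ 2)⁻¹) + 4 / 3 * (d ^ 2 * ξ)⁻¹ := by
        field_simp; ring
      _ ≤ (1 + |b|) * (1 / 3 * (d * ξ ^ 2)⁻¹) + (1 + |b|) * (4 / 3 * (d ^ 2 * ξ)⁻¹) := by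
        have hX : 0 ≤ 4 / 3 * (d ^ 2 * ξ)⁻¹ := by positivity
        exact add_le_add_right (le_mul_of_one_le_left hX (by linarith [abs_nonneg b])) _
      _ ≤ B' ξ := by
        have i1 : (d * ξ ^ 2)⁻¹ ≤ (d ^ 2 * ξ)⁻¹ + (ξ ^ 2)⁻¹ := by
          rcases le_total d ξ with h | h
          · refine le_trans ?_ (le_add_of_nonneg_right (by positivity))
            gcongr ?_⁻¹
            nlinarith [mul_pos hdξ h0]
          · refine le_trans ?_ (le_add_of_nonneg_left (by positivity))
            gcongr ?_⁻¹
            nlinarith [pow_pos h0 2]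
        have i2 : (d ^ 2 * ξ)⁻¹ ≤ 2 * (m⁻¹ * (d ^ 2)⁻¹) + (ξ ^ 2)⁻¹ := by
          rcases le_total (m / 2) ξ with h | h
          · refine le_trans ?_ (le_add_of_nonneg_right (by positivity))
            rw [mul_inv, mul_comm, ← mul_assoc]
            gcongr
            rw [inv_le_comm₀ h0 (by positivity), mul_inv, inv_inv]
            linarith
          · refine le_trans ?_ (le_add_of_nonneg_left (by positivity))
            have : ξ ≤ d := by
              rw [hdd, abs_sub_comm]; exact le_trans (by linarith) (le_abs_self _)
            gcongr ?_⁻¹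
            nlinarith [pow_pos h0 2, mul_pos h0 h0, mul_pos hdξ hdξ]
        simp only [hB', hd2]
        have hX : 0 ≤ m⁻¹ * (d ^ 2)⁻¹ := by positivity
        have hb : 0 ≤ 1 + |b| := by positivity
        rw [← mul_add, mul_comm (4 : ℝ), mul_assoc (1 + |b|)]
        refine mul_le_mul_of_nonneg_left ?_ hb
        have hY : 0 ≤ (ξ ^ 2)⁻¹ := by positivity
        linarith
  have hB'c : ContinuousOn B' (Set.Icc u v) := by
    refine ContinuousOn.mul continuousOn_const (ContinuousOn.add (ContinuousOn.mul
      continuousOn_const (ContinuousOn.inv₀ (by fun_prop) fun ξ hξ => pow_ne_zero 2 (hsub ξ hξ)))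
      (ContinuousOn.inv₀ (by fun_prop) fun ξ hξ => ?_))
    have := hξ1 ξ hξ
    positivity
  have hB'i : IntervalIntegrable B' volume u v := (hB'c.mono huIcc.le).intervalIntegrable
  have hint : ‖∫ ξ in u..v, w' ξ * quarticOsc x ξ‖ ≤ B v - B u := by
    rw [← intervalIntegral.integral_eq_sub_of_hasDerivAt (fun ξ hξ => hBd ξ (huIcc ▸ hξ)) hB'i]
    exact intervalIntegral.norm_integral_le_of_norm_le huv
      (.of_forall fun ξ hξ => hw'b ξ (Set.Ioc_subset_Icc_self hξ)) hB'i
  have hu' : u ∈ Set.Icc u v := Set.left_mem_Icc.2 huv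
  have hv' : v ∈ Set.Icc u v := Set.right_mem_Icc.2 huv
  have hBB : B v - B u ≤ 12 * (1 + |b|) := by
    have hone : ∀ ξ ∈ Set.Icc u v, |m⁻¹ * (ξ - m)⁻¹| ≤ 1 := fun ξ hξ => by
      rw [← mul_inv, abs_inv, abs_mul, abs_of_pos (by linarith : 0 < m)]
      exact inv_le_one_of_one_le₀ (hdist ξ hξ)
    have h1 := abs_le.1 (hone u hu')
    have h2 := abs_le.1 (hone v hv')
    have h3 : u⁻¹ ≤ 1 := inv_le_one_of_one_le₀ hu
    have h4 : 0 < v⁻¹ := by have := hξ1 v hv'; positivity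
    have hb : 0 ≤ 1 + |b| := by positivity
    simp only [hB]
    rw [← mul_sub, mul_assoc, show 12 * (1 + |b|) = 4 * ((1 + |b|) * 3) by ring]
    gcongr
    linarith [h1.1, h1.2, h2.1, h2.2]
  rw [hlhs, hibp]
  calc _ ≤ ‖w v * quarticOsc x v‖ + ‖w u * quarticOsc x u‖ + _ :=
        (norm_sub_le _ _).trans (add_le_add_left (norm_sub_le _ _) _)
    _ ≤ 2 / 3 + 2 / 3 + 12 * (1 + |b|) := by
        rw [norm_mul, norm_mul, norm_quarticOsc, norm_quarticOsc, mul_one, mul_one]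
        exact add_le_add (add_le_add (hwb v hv') (hwb u hu')) (hint.trans hBB)
    _ ≤ _ := by linarith [abs_nonneg b]

lemma norm_integral_powAmp_mul_quarticOsc_le_mul (a b x : ℝ) {u v M : ℝ} (hu : 0 < u)
    (huv : u ≤ v) (hM : ∀ ξ ∈ Set.Icc u v, ξ ^ a ≤ M) :
    ‖∫ ξ in u..v, powAmp a b ξ * quarticOsc x ξ‖ ≤ M * (v - u) := by
  have := intervalIntegral.norm_integral_le_of_norm_le_const (a := u) (b := v) (C := M)
    (f := fun ξ => powAmp a b ξ * quarticOsc x ξ) fun ξ hξ => by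
      rw [Set.uIoc_of_le huv] at hξ
      rw [norm_mul, norm_quarticOsc, mul_one, norm_powAmp _ _ (hu.trans hξ.1)]
      exact hM ξ (Set.Ioc_subset_Icc_self hξ)
  rwa [abs_of_nonneg (by linarith)] at this

lemma norm_integral_le_add_of_split {f : ℝ → ℂ}
    (hf : ∀ u v, 0 < u → u ≤ v → IntervalIntegrable f volume u v) {lo c hi C₁ C₂ : ℝ}
    (hC₁ : 0 ≤ C₁) (hC₂ : 0 ≤ C₂)
    (h₁ : ∀ u v, 0 < u → lo ≤ u → u ≤ v → v ≤ c → ‖∫ ξ in u..v, f ξ‖ ≤ C₁)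
    (h₂ : ∀ u v, 0 < u → c ≤ u → u ≤ v → v ≤ hi → ‖∫ ξ in u..v, f ξ‖ ≤ C₂) :
    ∀ u v, 0 < u → lo ≤ u → u ≤ v → v ≤ hi → ‖∫ ξ in u..v, f ξ‖ ≤ C₁ + C₂ := by
  intro u v hu hlo huv hhi
  rcases le_total v c with hvc | hvc
  · linarith [h₁ u v hu hlo huv hvc]
  rcases le_total c u with hcu | hcu
  · linarith [h₂ u v hu hcu huv hhi]
  rw [← intervalIntegral.integral_add_adjacent_intervals (hf u c hu hcu)
    (hf c v (hu.trans_le hcu) hvc)]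
  exact (norm_add_le _ _).trans (add_le_add (h₁ u c hu hlo hcu le_rfl)
    (h₂ c v (hu.trans_le hcu) le_rfl hvc hhi))

lemma norm_integral_powAmp_mul_quarticOsc_le {a : ℝ} (ha0 : 0 ≤ a) (ha1 : a ≤ 1) (b x : ℝ)
    {u v : ℝ} (hu : 0 < u) (huv : u ≤ v) :
    ‖∫ ξ in u..v, powAmp a b ξ * quarticOsc x ξ‖ ≤ 33 * (1 + |b|) := by
  obtain ⟨c, hc⟩ : ∃ c : ℝ, c ^ 3 = -x / 4 :=
    ((by fun_prop : Continuous fun c : ℝ => c ^ 3).surjective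
        (Filter.tendsto_pow_atTop (by norm_num))
        (by
          have := (Filter.tendsto_pow_atTop (α := ℝ) (n := 3) (by norm_num)).comp
            Filter.tendsto_neg_atBot_atTop
          have h2 := Filter.tendsto_neg_atTop_atBot.comp this
          refine h2.congr fun y => ?_
          simp only [Function.comp]; ring)) (-x / 4)
  set m := max c 1 with hm
  have hm1 : 1 ≤ m := le_max_right _ _
  have hm0 : 0 < m := by linarith
  have hmi : m⁻¹ ≤ 1 := inv_le_one_of_one_le₀ hm1
  have hmi0 : 0 < m⁻¹ := by positivity
  have hmm : m * m⁻¹ = 1 := mul_inv_cancel₀ hm0.ne'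
  have hx : ∀ ξ : ℝ, x + 4 * ξ ^ 3 = 4 * (ξ - c) * (ξ ^ 2 + ξ * c + c ^ 2) := fun ξ => by
    linear_combination 4 * hc
  have hq : ∀ ξ : ℝ, 3 * ξ ^ 2 ≤ 4 * (ξ ^ 2 + ξ * c + c ^ 2) := fun ξ => by
    nlinarith [sq_nonneg (ξ + 2 * c)]
  have hphase : ∀ ξ : ℝ, |ξ - m| ≤ |ξ - c| → 3 * |ξ - m| * ξ ^ 2 ≤ |x + 4 * ξ ^ 3| := by
    intro ξ h
    rw [hx, abs_mul, abs_mul, abs_of_nonneg (by positivity : (0 : ℝ) ≤ 4)]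
    have h3 := le_abs_self (ξ ^ 2 + ξ * c + c ^ 2)
    nlinarith [hq ξ, abs_nonneg (ξ - m), sq_nonneg ξ, abs_nonneg (ξ - c),
      abs_nonneg (ξ ^ 2 + ξ * c + c ^ 2), mul_nonneg (sub_nonneg.2 h) (sq_nonneg ξ),
      mul_nonneg (abs_nonneg (ξ - c)) (sub_nonneg.2 ((hq ξ).trans (mul_le_mul_of_nonneg_left h3
        (by norm_num : (0 : ℝ) ≤ 4))))]
  have hf := fun u v (hu : 0 < u) (huv : u ≤ v) =>
    intervalIntegrable_powAmp_mul_quarticOsc a b x hu huv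
  have hb : 0 ≤ 14 * (1 + |b|) := by positivity
  have s1 : ∀ u v : ℝ, 0 < u → 0 ≤ u → u ≤ v → v ≤ 1 →
      ‖∫ ξ in u..v, powAmp a b ξ * quarticOsc x ξ‖ ≤ 1 := by
    intro u v hu _ huv hv
    have := norm_integral_powAmp_mul_quarticOsc_le_mul a b x (M := 1) hu huv fun ξ hξ =>
      Real.rpow_le_one (by linarith [hξ.1]) (by linarith [hξ.2]) ha0
    linarith
  have s2 : ∀ u v : ℝ, 0 < u → 1 ≤ u → u ≤ v → v ≤ m - m⁻¹ →
      ‖∫ ξ in u..v, powAmp a b ξ * quarticOsc x ξ‖ ≤ 14 * (1 + |b|) := by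
    intro u v _ hu huv hv
    have hmc : m = c := by
      rcases max_choice c 1 with h | h
      · exact h
      · rw [← hm] at h
        linarith
    refine norm_integral_powAmp_mul_quarticOsc_le_of_nonstationary ha0 ha1 b x hm1 hu huv
      (fun ξ hξ => ?_) (fun ξ _ => hphase ξ (by rw [hmc]))
    rw [abs_sub_comm]
    nlinarith [le_abs_self (m - ξ), hξ.2]
  have s3 : ∀ u v : ℝ, 0 < u → m - m⁻¹ ≤ u → u ≤ v → v ≤ m + m⁻¹ →
      ‖∫ ξ in u..v, powAmp a b ξ * quarticOsc x ξ‖ ≤ 4 := by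
    intro u v hu hu2 huv hv
    have := norm_integral_powAmp_mul_quarticOsc_le_mul a b x (M := m + m⁻¹) hu huv fun ξ hξ => by
      have hξ0 : 0 < ξ := by linarith [hξ.1]
      have hle : ξ ≤ m + m⁻¹ := by linarith [hξ.2]
      rcases le_total ξ 1 with h | h
      · linarith [Real.rpow_le_one hξ0.le h ha0]
      · exact le_trans (by simpa using Real.rpow_le_rpow_of_exponent_le h ha1) hle
    nlinarith
  have s4 : ∀ u w : ℝ, 0 < u → m + m⁻¹ ≤ u → u ≤ w → w ≤ v →
      ‖∫ ξ in u..w, powAmp a b ξ * quarticOsc x ξ‖ ≤ 14 * (1 + |b|) := by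
    intro u w _ hu huw _
    refine norm_integral_powAmp_mul_quarticOsc_le_of_nonstationary ha0 ha1 b x hm1
      (by linarith) huw (fun ξ hξ => ?_) (fun ξ hξ => hphase ξ ?_)
    · nlinarith [le_abs_self (ξ - m), hξ.1]
    · have := le_max_left c 1
      rw [abs_of_nonneg (by linarith [hξ.1]), abs_of_nonneg (by linarith [hξ.1])]
      linarith
  have t1 := norm_integral_le_add_of_split hf zero_le_one hb s1 s2
  have t2 := norm_integral_le_add_of_split hf (by linarith) (by norm_num) t1 s3
  have t3 := norm_integral_le_add_of_split hf (by linarith) hb t2 s4 u v hu hu.le huv le_rfl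
  linarith [abs_nonneg b]

end OscillatoryIntegral

section Kernel

/-- The frequency annulus `δ ≤ |ξ| ≤ N`. -/
def freqAnnulus (δ N : ℝ) : Set ℝ := Set.Icc δ N ∪ Set.Icc (-N) (-δ)

lemma measurableSet_freqAnnulus (δ N : ℝ) : MeasurableSet (freqAnnulus δ N) :=
  measurableSet_Icc.union measurableSet_Icc

lemma mem_freqAnnulus {δ N ξ : ℝ} (hδ : 0 < δ) (h : ξ ∈ freqAnnulus δ N) : δ ≤ |ξ| ∧ |ξ| ≤ N := by
  rcases h with h | h
  · rw [abs_of_pos (hδ.trans_le h.1)]; exact h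
  · rw [abs_of_neg (by linarith [h.2])]; exact ⟨by linarith [h.2], by linarith [h.1]⟩

lemma isCompact_freqAnnulus (δ N : ℝ) : IsCompact (freqAnnulus δ N) :=
  isCompact_Icc.union isCompact_Icc

lemma norm_integral_powAmp_mul_exp_le_of_pos {a : ℝ} (ha0 : 0 ≤ a) (ha1 : a ≤ 1) (b x : ℝ)
    {T : ℝ} (hT : 0 < T) {u v : ℝ} (hu : 0 < u) (huv : u ≤ v) :
    ‖∫ ξ in u..v, powAmp a b ξ * cexp (I * (x * ξ + T * ξ ^ 4))‖ ≤
      33 * (1 + |b|) * T ^ (-((1 + a) / 4)) := by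
  set κ := T ^ (1 / 4 : ℝ) with hκ
  have hκ0 : 0 < κ := by positivity
  have hκ4 : κ ^ 4 = T := by
    rw [hκ, ← Real.rpow_natCast, ← Real.rpow_mul hT.le]; norm_num
  have e1 : ∫ ξ in u..v, powAmp a b ξ * cexp (I * (x * ξ + T * ξ ^ 4)) =
      powAmp a b κ⁻¹ * ∫ ξ in u..v, powAmp a b (κ * ξ) * quarticOsc (x / κ) (κ * ξ) := by
    rw [← intervalIntegral.integral_const_mul]
    refine intervalIntegral.integral_congr fun ξ hξ => ?_
    rw [Set.uIcc_of_le huv] at hξ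
    have hξ0 : 0 < ξ := hu.trans_le hξ.1
    have hκc : (κ : ℂ) ≠ 0 := by exact_mod_cast hκ0.ne'
    have e2 : powAmp a b ξ = powAmp a b κ⁻¹ * powAmp a b (κ * ξ) := by
      rw [powAmp, powAmp, powAmp, ← Complex.exp_add, ← mul_add, Real.log_inv,
        Real.log_mul hκ0.ne' hξ0.ne']
      push_cast
      congr 2
      ring
    have e3 : quarticOsc (x / κ) (κ * ξ) = cexp (I * (x * ξ + T * ξ ^ 4)) := by
      rw [quarticOsc, ← hκ4]
      push_cast
      congr 2
      field_simp
    simp only [e2, e3, mul_assoc]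
  have e4 := intervalIntegral.integral_comp_mul_left (a := u) (b := v)
    (fun η => powAmp a b η * quarticOsc (x / κ) η) hκ0.ne'
  rw [e1, e4, norm_mul, norm_smul, norm_powAmp _ _ (by positivity), norm_inv,
    Real.norm_of_nonneg hκ0.le]
  have h := norm_integral_powAmp_mul_quarticOsc_le ha0 ha1 b (x / κ) (mul_pos hκ0 hu)
    (mul_le_mul_of_nonneg_left huv hκ0.le)
  have hpw : κ⁻¹ ^ a * κ⁻¹ = T ^ (-((1 + a) / 4)) := by
    rw [← Real.rpow_add_one (by positivity), hκ, ← Real.rpow_neg hT.le, ← Real.rpow_mul hT.le]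
    congr 1; ring
  calc _ ≤ κ⁻¹ ^ a * (κ⁻¹ * (33 * (1 + |b|))) := by gcongr
    _ = _ := by rw [← hpw]; ring

lemma norm_integral_powAmp_mul_exp_le {a : ℝ} (ha0 : 0 ≤ a) (ha1 : a ≤ 1) (b x : ℝ)
    {T : ℝ} (hT : T ≠ 0) {u v : ℝ} (hu : 0 < u) (huv : u ≤ v) :
    ‖∫ ξ in u..v, powAmp a b ξ * cexp (I * (x * ξ + T * ξ ^ 4))‖ ≤
      33 * (1 + |b|) * |T| ^ (-((1 + a) / 4)) := by
  rcases lt_or_gt_of_ne hT with h | h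
  · have key := norm_integral_powAmp_mul_exp_le_of_pos ha0 ha1 (-b) (-x) (neg_pos.2 h) hu huv
    rw [abs_neg] at key
    rw [abs_of_neg h, ← Complex.norm_conj]
    convert key using 2
    rw [intervalIntegral.integral_of_le huv, intervalIntegral.integral_of_le huv, ← integral_conj]
    refine integral_congr_ae (.of_forall fun ξ => ?_)
    simp only [map_mul, powAmp, ← Complex.exp_conj, map_add, conj_ofReal, conj_I, map_pow]
    push_cast
    congr 2 <;> ring
  · rw [abs_of_pos h]
    exact norm_integral_powAmp_mul_exp_le_of_pos ha0 ha1 b x h hu huv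

lemma continuousOn_powAmp_abs (a b : ℝ) : ContinuousOn (fun ξ => powAmp a b |ξ|) {0}ᶜ :=
  (continuousOn_powAmp a b).comp continuous_abs.continuousOn fun _ hξ => abs_pos.2 hξ

/-- The dispersive kernel estimate, uniformly in the frequency truncation. -/
lemma norm_setIntegral_freqAnnulus_le {a : ℝ} (ha0 : 0 ≤ a) (ha1 : a ≤ 1) (b x : ℝ)
    {T : ℝ} (hT : T ≠ 0) {δ N : ℝ} (hδ : 0 < δ) (hδN : δ ≤ N) :
    ‖∫ ξ in freqAnnulus δ N, powAmp a b |ξ| * cexp (I * (x * ξ + T * ξ ^ 4))‖ ≤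
      66 * (1 + |b|) * |T| ^ (-((1 + a) / 4)) := by
  have hcont : ContinuousOn (fun ξ : ℝ => powAmp a b |ξ| * cexp (I * (x * ξ + T * ξ ^ 4)))
      (freqAnnulus δ N) :=
    ((continuousOn_powAmp_abs a b).mono fun ξ hξ => by
      have := (mem_freqAnnulus hδ hξ).1
      exact abs_pos.1 (hδ.trans_le this)).mul (by fun_prop)
  have hint := hcont.integrableOn_compact (isCompact_freqAnnulus δ N) (μ := volume)
  have hdisj : Disjoint (Set.Icc δ N) (Set.Icc (-N) (-δ)) := by
    rw [Set.disjoint_left]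
    intro ξ h1 h2
    linarith [h1.1, h2.2]
  have e1 : ∫ ξ in Set.Icc δ N, powAmp a b |ξ| * cexp (I * (x * ξ + T * ξ ^ 4)) =
      ∫ ξ in δ..N, powAmp a b ξ * cexp (I * (x * ξ + T * ξ ^ 4)) := by
    rw [integral_Icc_eq_integral_Ioc, ← intervalIntegral.integral_of_le hδN]
    refine intervalIntegral.integral_congr fun ξ hξ => ?_
    rw [Set.uIcc_of_le hδN] at hξ
    simp only [abs_of_pos (hδ.trans_le hξ.1)]
  have e2 : ∫ ξ in Set.Icc (-N) (-δ), powAmp a b |ξ| * cexp (I * (x * ξ + T * ξ ^ 4)) =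
      ∫ ξ in δ..N, powAmp a b ξ * cexp (I * ((-x : ℝ) * ξ + T * ξ ^ 4)) := by
    rw [integral_Icc_eq_integral_Ioc, ← intervalIntegral.integral_of_le (by linarith),
      ← intervalIntegral.integral_comp_neg]
    refine intervalIntegral.integral_congr fun ξ hξ => ?_
    rw [Set.uIcc_of_le hδN] at hξ
    simp only [abs_neg, abs_of_pos (hδ.trans_le hξ.1)]
    push_cast
    congr 3
    ring
  rw [freqAnnulus, setIntegral_union hdisj measurableSet_Icc
    (hint.mono_set Set.subset_union_left) (hint.mono_set Set.subset_union_right), e1, e2]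
  refine (norm_add_le _ _).trans ?_
  linarith [norm_integral_powAmp_mul_exp_le ha0 ha1 b x hT hδ hδN,
    norm_integral_powAmp_mul_exp_le ha0 ha1 b (-x) hT hδ hδN]

end Kernel

section AnalyticFamily

open HadamardThreeLines

variable {X : Type*} {c : X → ℂ} {a : X → ℝ}

lemma exp_mul_le_one_add_exp {s a : ℝ} (h0 : 0 ≤ s) (h1 : s ≤ 1) :
    Real.exp (s * a) ≤ 1 + Real.exp a := by
  rcases le_total 0 a with h | h
  · have : Real.exp (s * a) ≤ Real.exp a := Real.exp_le_exp.2 (by nlinarith)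
    linarith
  · have : Real.exp (s * a) ≤ 1 := Real.exp_le_one_iff.2 (by nlinarith)
    linarith [Real.exp_pos a]

lemma norm_mul_cexp_le {z : ℂ} (h0 : 0 ≤ z.re) (h1 : z.re ≤ 1) (w : X) :
    ‖c w * cexp (z * a w)‖ ≤ ‖c w‖ + ‖c w * cexp (a w)‖ := by
  rw [norm_mul, norm_mul, Complex.norm_exp, Complex.norm_exp, Complex.re_mul_ofReal,
    Complex.ofReal_re]
  have := exp_mul_le_one_add_exp (a := a w) h0 h1
  nlinarith [norm_nonneg (c w)]

lemma abs_mul_exp_le {η s a : ℝ} (hη : 0 < η) (h0 : η ≤ s) (h1 : s ≤ 1 - η) :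
    |a| * Real.exp (s * a) ≤ η⁻¹ * (1 + Real.exp a) := by
  have hle : η * |a| ≤ Real.exp (η * |a|) := by linarith [Real.add_one_le_exp (η * |a|)]
  have h2 : η * (|a| * Real.exp (s * a)) ≤ 1 + Real.exp a := by
    calc η * (|a| * Real.exp (s * a)) ≤ Real.exp (η * |a|) * Real.exp (s * a) := by
          rw [← mul_assoc]; gcongr
      _ = Real.exp (η * |a| + s * a) := (Real.exp_add _ _).symm
      _ ≤ 1 + Real.exp a := by
          rcases le_total 0 a with h | h
          · rw [abs_of_nonneg h, ← add_mul]
            exact exp_mul_le_one_add_exp (by linarith) (by linarith)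
          · rw [abs_of_nonpos h, mul_neg, ← sub_eq_neg_add, ← sub_mul]
            exact exp_mul_le_one_add_exp (by linarith) (by linarith)
  rwa [← div_eq_inv_mul, le_div_iff₀ hη, mul_comm]

variable [MeasurableSpace X] {μ : Measure X}

lemma diffContOnCl_integral_mul_cexp (hc : Integrable c μ)
    (hca : Integrable (fun w => c w * cexp (a w)) μ) (ha : Measurable a) :
    DiffContOnCl ℂ (fun z : ℂ => ∫ w, c w * cexp (z * a w) ∂μ) (verticalStrip 0 1) := by
  have hmeas : ∀ z : ℂ, AEStronglyMeasurable (fun w => c w * cexp (z * a w)) μ := fun z =>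
    hc.1.mul (by fun_prop : Measurable fun w => cexp (z * a w)).aestronglyMeasurable
  refine ⟨fun z₀ hz₀ => ?_, ?_⟩
  · have hz₀ : 0 < z₀.re ∧ z₀.re < 1 := hz₀
    set η := min z₀.re (1 - z₀.re) / 2 with hη
    have hη0 : 0 < η := by
      have : 0 < min z₀.re (1 - z₀.re) := lt_min hz₀.1 (by linarith)
      positivity
    have hη1 : 2 * η ≤ z₀.re := by
      rw [hη]; linarith [min_le_left z₀.re (1 - z₀.re)]
    have hη2 : 2 * η ≤ 1 - z₀.re := by
      rw [hη]; linarith [min_le_right z₀.re (1 - z₀.re)]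
    refine (hasDerivAt_integral_of_dominated_loc_of_deriv_le (μ := μ) (𝕜 := ℂ)
      (F := fun z w => c w * cexp (z * a w))
      (F' := fun z w => c w * (cexp (z * a w) * a w)) (x₀ := z₀)
      (s := Metric.ball z₀ η) (bound := fun w => η⁻¹ * (‖c w‖ + ‖c w * cexp (a w)‖))
      (Metric.ball_mem_nhds z₀ hη0) (.of_forall hmeas) ?_ ?_ ?_ ?_
      ?_).2.differentiableAt.differentiableWithinAt
    · exact (hc.norm.add hca.norm).mono' (hmeas z₀)
        (.of_forall fun w => norm_mul_cexp_le hz₀.1.le hz₀.2.le w)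
    · exact hc.1.mul (by fun_prop : Measurable fun w =>
        cexp (z₀ * a w) * a w).aestronglyMeasurable
    · refine .of_forall fun w z hz => ?_
      have hd : |z.re - z₀.re| < η := by
        rw [Metric.mem_ball, dist_eq_norm] at hz
        exact lt_of_le_of_lt (by simpa using Complex.abs_re_le_norm (z - z₀)) hz
      have hd' := abs_lt.1 hd
      have hb := abs_mul_exp_le (a := a w) hη0 (s := z.re) (by linarith) (by linarith)
      rw [norm_mul, norm_mul, norm_mul, Complex.norm_exp, Complex.norm_exp, Complex.re_mul_ofReal,
        Complex.ofReal_re, Complex.norm_real, Real.norm_eq_abs]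
      calc _ = ‖c w‖ * (|a w| * Real.exp (z.re * a w)) := by ring
        _ ≤ ‖c w‖ * (η⁻¹ * (1 + Real.exp (a w))) := by gcongr
        _ = _ := by ring
    · exact (hc.norm.add hca.norm).const_mul _
    · refine .of_forall fun w z _ => ?_
      have := ((((hasDerivAt_id z).mul_const (a w : ℂ))).cexp).const_mul (c w)
      simpa using this
  · refine ContinuousOn.mono (s := re ⁻¹' Set.Icc 0 1) ?_
      (closure_minimal (Set.preimage_mono Set.Ioo_subset_Icc_self)
        (isClosed_Icc.preimage continuous_re))
    refine continuousOn_of_dominated (bound := fun w => ‖c w‖ + ‖c w * cexp (a w)‖)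
      (fun z _ => hmeas z) (fun z hz => .of_forall fun w => norm_mul_cexp_le hz.1 hz.2 w)
      (hc.norm.add hca.norm) (.of_forall fun w => by fun_prop)

/-- Three lines theorem for a Laplace-type integral that grows linearly on the right edge. -/
lemma norm_integral_mul_cexp_le_interp (hc : Integrable c μ)
    (hca : Integrable (fun w => c w * cexp (a w)) μ) (ha : Measurable a) {A B : ℝ}
    (hA : ∀ z : ℂ, z.re = 0 → ‖∫ w, c w * cexp (z * a w) ∂μ‖ ≤ A)
    (hB : ∀ z : ℂ, z.re = 1 → ‖∫ w, c w * cexp (z * a w) ∂μ‖ ≤ (1 + |z.im|) * B)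
    {θ : ℝ} (h0 : 0 ≤ θ) (h1 : θ ≤ 1) :
    ‖∫ w, c w * cexp (θ * a w) ∂μ‖ ≤ 2 * (A ^ (1 - θ) * (2 * B) ^ θ) := by
  set Φ : ℂ → ℂ := fun z => ∫ w, c w * cexp (z * a w) ∂μ with hΦ
  have hre : ∀ z : ℂ, z.re ≤ ‖1 + z‖ - 1 := fun z => by
    have := Complex.re_le_norm (1 + z)
    simp only [add_re, one_re] at this
    linarith
  have hB0 : 0 ≤ B := by
    have := (norm_nonneg _).trans (hB 1 (by simp))
    simpa using this
  have hA0 : 0 ≤ A := (norm_nonneg _).trans (hA 0 (by simp))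
  have hcl : closure (verticalStrip 0 1) ⊆ re ⁻¹' Set.Icc 0 1 :=
    closure_minimal (Set.preimage_mono Set.Ioo_subset_Icc_self)
      (isClosed_Icc.preimage continuous_re)
  have hne : ∀ z : ℂ, 0 ≤ z.re → 1 ≤ ‖1 + z‖ := fun z hz => by linarith [hre z]
  have hd : DiffContOnCl ℂ (fun z => (1 + z)⁻¹ * Φ z) (verticalStrip 0 1) := by
    have hlin : DiffContOnCl ℂ (fun z : ℂ => 1 + z) (verticalStrip 0 1) :=
      (by fun_prop : Differentiable ℂ fun z : ℂ => 1 + z).diffContOnCl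
    have := (hlin.inv fun z hz => norm_pos_iff.1 (by
      linarith [hne z (hcl hz).1])).smul (diffContOnCl_integral_mul_cexp hc hca ha)
    exact this
  have hbound : ∀ z : ℂ, 0 ≤ z.re → ‖(1 + z)⁻¹ * Φ z‖ ≤ ‖Φ z‖ := fun z hz => by
    rw [norm_mul, norm_inv]
    exact mul_le_of_le_one_left (norm_nonneg _) (inv_le_one_of_one_le₀ (hne z hz))
  have key := norm_le_interp_of_mem_verticalClosedStrip' (f := fun z => (1 + z)⁻¹ * Φ z)
    (z := (θ : ℂ)) (a := A) (b := 2 * B) (l := 0) (u := 1) zero_lt_one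
    (by show (θ : ℂ).re ∈ Set.Icc 0 1; simpa using ⟨h0, h1⟩) hd ?_ ?_ ?_
  · simp only [ofReal_re, sub_zero, div_one] at key
    rw [norm_mul, norm_inv] at key
    have hn : ‖(1 + θ : ℂ)‖ = 1 + θ := by
      rw [show (1 + θ : ℂ) = ((1 + θ : ℝ) : ℂ) by push_cast; rfl, Complex.norm_real,
        Real.norm_of_nonneg (by linarith)]
    rw [hn, inv_mul_le_iff₀ (by linarith)] at key
    refine key.trans ?_
    gcongr
    linarith
  · refine ⟨∫ w, (‖c w‖ + ‖c w * cexp (a w)‖) ∂μ, ?_⟩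
    rintro _ ⟨z, hz, rfl⟩
    have hz : 0 ≤ z.re ∧ z.re ≤ 1 := hz
    exact (hbound z hz.1).trans (norm_integral_le_of_norm_le (hc.norm.add hca.norm)
      (.of_forall fun w => norm_mul_cexp_le hz.1 hz.2 w))
  · intro z hz
    have hz : z.re = 0 := hz
    exact (hbound z hz.ge).trans (hA z hz)
  · intro z hz
    have hz : z.re = 1 := hz
    rw [norm_mul, norm_inv, inv_mul_le_iff₀ (by linarith [hre z])]
    refine (hB z hz).trans ?_
    have := Complex.abs_im_le_norm (1 + z)
    simp only [add_im, one_im, zero_add] at this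
    nlinarith [hre z]

end AnalyticFamily

section Pairing

/-- The integrand of the pairing `∫ m(ξ) û(ξ) v̂(-ξ) dξ`, before integration in space. -/
noncomputable def pairingIntegrand (m u v : ℝ → ℂ) (w : ℝ × ℝ × ℝ) : ℂ :=
  m w.1 * ((cexp (-(I * w.2.1 * w.1)) * u w.2.1) * (cexp (-(I * w.2.2 * (-w.1 : ℝ))) * v w.2.2))

lemma norm_cexp_neg_I_mul (x ξ : ℝ) : ‖cexp (-(I * x * ξ))‖ = 1 := by
  rw [Complex.norm_exp]
  simp

variable {A : Set ℝ} {m u v : ℝ → ℂ}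

lemma integrable_pairingIntegrand (hm : IntegrableOn m A) (hu : Integrable u)
    (hv : Integrable v) :
    Integrable (pairingIntegrand m u v) ((volume.restrict A).prod (volume.prod volume)) := by
  have h := Integrable.mul_prod hm (hu.mul_prod hv)
  refine (h.bdd_mul (c := 1) (f := fun w : ℝ × ℝ × ℝ =>
    cexp (-(I * w.2.1 * w.1)) * cexp (-(I * w.2.2 * (-w.1 : ℝ)))) ?_ ?_).congr ?_
  · fun_prop
  · refine .of_forall fun w => ?_
    rw [norm_mul, norm_cexp_neg_I_mul, norm_cexp_neg_I_mul, one_mul]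
  · refine .of_forall fun w => ?_
    simp only [pairingIntegrand]
    ring

lemma integral_pairingIntegrand (hm : IntegrableOn m A) (hu : Integrable u) (hv : Integrable v) :
    ∫ w, pairingIntegrand m u v w ∂((volume.restrict A).prod (volume.prod volume)) =
      ∫ ξ in A, m ξ * (fourierInt u ξ * fourierInt v (-ξ)) := by
  rw [integral_prod _ (integrable_pairingIntegrand hm hu hv)]
  refine integral_congr_ae (.of_forall fun ξ => ?_)
  simp only [pairingIntegrand, fourierInt]
  rw [integral_const_mul, ← integral_prod_mul]

lemma norm_integral_pairingIntegrand_le (hm : IntegrableOn m A) (hu : Integrable u)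
    (hv : Integrable v) {K : ℝ} (hK : ∀ x : ℝ, ‖∫ ξ in A, m ξ * cexp (I * (x * ξ))‖ ≤ K) :
    ‖∫ w, pairingIntegrand m u v w ∂((volume.restrict A).prod (volume.prod volume))‖ ≤
      K * ((∫ x, ‖u x‖) * ∫ x, ‖v x‖) := by
  rw [integral_prod_symm _ (integrable_pairingIntegrand hm hu hv), ← integral_prod_mul,
    ← integral_const_mul]
  refine norm_integral_le_of_norm_le ((hu.norm.mul_prod hv.norm).const_mul K)
    (.of_forall fun ⟨x, y⟩ => ?_)
  have : ∫ ξ in A, pairingIntegrand m u v (ξ, x, y) =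
      (∫ ξ in A, m ξ * cexp (I * ((y - x : ℝ) * ξ))) * (u x * v y) := by
    rw [← integral_mul_const]
    refine integral_congr_ae (.of_forall fun ξ => ?_)
    simp only [pairingIntegrand]
    have : cexp (I * ((y - x : ℝ) * ξ)) = cexp (-(I * x * ξ)) * cexp (-(I * y * (-ξ : ℝ))) := by
      rw [← Complex.exp_add]
      congr 1
      push_cast
      ring
    rw [this]
    ring
  rw [this, norm_mul, norm_mul]
  gcongr
  exact hK _

lemma continuous_fourierInt (hu : Integrable u) : Continuous (fourierInt u) := by
  have hcont : Continuous (𝓕 u) :=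
    VectorFourier.fourierIntegral_continuous Real.continuous_fourierChar continuous_inner hu
  simp_rw [funext (fourierInt_eq u)]
  fun_prop

lemma eLpNorm_fourierInt_eq (h1 : Integrable u) (h2 : MemLp u 2) :
    eLpNorm (fourierInt u) 2 volume =
      (ENNReal.ofReal (2 * Real.pi)) ^ (1 / 2 : ℝ) * eLpNorm u 2 volume := by
  have := lintegral_enorm_fourierInt_sq h1 h2
  rw [lintegral_enorm_sq_eq, lintegral_enorm_sq_eq] at this
  have h3 := congrArg (fun z : ℝ≥0∞ => z ^ (1 / 2 : ℝ)) this
  have hsq : ∀ z : ℝ≥0∞, (z ^ 2) ^ (1 / 2 : ℝ) = z := fun z => by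
    rw [← ENNReal.rpow_natCast, ← ENNReal.rpow_mul]
    norm_num
  simpa only [ENNReal.mul_rpow_of_nonneg _ _ (by norm_num : (0 : ℝ) ≤ 1 / 2), hsq] using h3

lemma norm_setIntegral_mul_fourierInt_le (hA : MeasurableSet A) (hm : ∀ ξ ∈ A, ‖m ξ‖ ≤ 1)
    (hu : Integrable u) (hu2 : MemLp u 2) (hv : Integrable v) (hv2 : MemLp v 2) :
    ‖∫ ξ in A, m ξ * (fourierInt u ξ * fourierInt v (-ξ))‖ ≤
      2 * Real.pi * (Real.sqrt (∫ x, ‖u x‖ ^ 2) * Real.sqrt (∫ x, ‖v x‖ ^ 2)) := by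
  have hF : ∀ w : ℝ → ℂ, MemLp w 2 →
      eLpNorm w 2 volume = ENNReal.ofReal (Real.sqrt (∫ x, ‖w x‖ ^ 2)) := by
    intro w hw
    rw [hw.eLpNorm_eq_integral_rpow_norm (by norm_num) (by norm_num), Real.sqrt_eq_rpow]
    norm_num
  have h2 : eLpNorm (fun ξ => fourierInt v (-ξ)) 2 volume = eLpNorm (fourierInt v) 2 volume :=
    eLpNorm_comp_measurePreserving (continuous_fourierInt hv).aestronglyMeasurable
      (Measure.measurePreserving_neg volume)
  have hmul : eLpNorm (fun ξ => fourierInt u ξ * fourierInt v (-ξ)) 1 volume ≤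
      eLpNorm (fourierInt u) 2 volume * eLpNorm (fun ξ => fourierInt v (-ξ)) 2 volume :=
    eLpNorm_smul_le_mul_eLpNorm (φ := fourierInt u) (f := fun ξ => fourierInt v (-ξ))
      ((continuous_fourierInt hv).comp continuous_neg).aestronglyMeasurable
      (continuous_fourierInt hu).aestronglyMeasurable
  have key : ‖∫ ξ in A, m ξ * (fourierInt u ξ * fourierInt v (-ξ))‖ₑ ≤
      eLpNorm (fourierInt u) 2 volume * eLpNorm (fun ξ => fourierInt v (-ξ)) 2 volume := by
    calc _ ≤ ∫⁻ ξ in A, ‖m ξ * (fourierInt u ξ * fourierInt v (-ξ))‖ₑ :=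
          enorm_integral_le_lintegral_enorm _
      _ ≤ ∫⁻ ξ in A, ‖fourierInt u ξ * fourierInt v (-ξ)‖ₑ := by
          refine setLIntegral_mono' hA fun ξ hξ => ?_
          rw [enorm_mul]
          refine mul_le_of_le_one_left (zero_le) ?_
          have := hm ξ hξ
          rw [← ofReal_norm]
          exact ENNReal.ofReal_le_one.2 this
      _ ≤ ∫⁻ ξ, ‖fourierInt u ξ * fourierInt v (-ξ)‖ₑ := setLIntegral_le_lintegral _ _
      _ = eLpNorm (fun ξ => fourierInt u ξ * fourierInt v (-ξ)) 1 volume :=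
          eLpNorm_one_eq_lintegral_enorm.symm
      _ ≤ _ := hmul
  rw [h2, eLpNorm_fourierInt_eq hu hu2, eLpNorm_fourierInt_eq hv hv2, hF u hu2, hF v hv2,
    ENNReal.ofReal_rpow_of_pos (by positivity), ← ENNReal.ofReal_mul (by positivity),
    ← ENNReal.ofReal_mul (by positivity), ← ENNReal.ofReal_mul (by positivity),
    ← ofReal_norm, ENNReal.ofReal_le_ofReal_iff (by positivity)] at key
  refine key.trans_eq ?_
  rw [mul_mul_mul_comm, ← Real.rpow_add (by positivity)]
  norm_num

end Pairing

section Dispersive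

/-- The analytic family through `f` used to interpolate between `L²` and `L¹`. -/
noncomputable def interpFamily (p : ℝ) (f : ℝ → ℂ) (z : ℂ) (x : ℝ) : ℂ :=
  ((‖f x‖ ^ (p / 2 - 1) : ℝ) : ℂ) * f x * cexp (z * (p / 2 * Real.log ‖f x‖ : ℝ))

lemma norm_interpFamily {p : ℝ} (hp : 0 < p) (f : ℝ → ℂ) {z : ℂ} (hz : 0 ≤ z.re) (x : ℝ) :
    ‖interpFamily p f z x‖ = ‖f x‖ ^ (p / 2 * (1 + z.re)) := by
  rw [interpFamily, norm_mul, norm_mul, Complex.norm_real, Complex.norm_exp, re_mul_ofReal,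
    Real.norm_of_nonneg (by positivity)]
  rcases eq_or_ne (f x) 0 with h | h
  · rw [h, norm_zero, mul_zero, zero_mul, Real.zero_rpow (by positivity)]
  · have hpos : 0 < ‖f x‖ := norm_pos_iff.2 h
    rw [← Real.rpow_add_one hpos.ne', Real.rpow_def_of_pos hpos, Real.rpow_def_of_pos hpos,
      ← Real.exp_add]
    congr 1
    ring

lemma interpFamily_ofReal {p θ : ℝ} (hp : p * (1 + θ) = 2) (f : ℝ → ℂ) (x : ℝ) :
    interpFamily p f θ x = f x := by
  rw [interpFamily]
  rcases eq_or_ne (f x) 0 with h | h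
  · simp [h]
  · have hpos : 0 < ‖f x‖ := norm_pos_iff.2 h
    have : ‖f x‖ ^ (p / 2 - 1) * Real.exp (θ * (p / 2 * Real.log ‖f x‖)) = 1 := by
      rw [Real.rpow_def_of_pos hpos, ← Real.exp_add, Real.exp_eq_one_iff]
      linear_combination (Real.log ‖f x‖ / 2) * hp
    rw [mul_right_comm, ← ofReal_mul, ← ofReal_exp, ← ofReal_mul, this, ofReal_one, one_mul]

lemma measurable_interpFamily {f : ℝ → ℂ} (hf : Measurable f) (p : ℝ) (z : ℂ) :
    Measurable (interpFamily p f z) := by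
  unfold interpFamily
  fun_prop

lemma interpFamily_eq (p : ℝ) (f : ℝ → ℂ) (z : ℂ) (x : ℝ) :
    interpFamily p f z x = interpFamily p f 0 x * cexp (z * (p / 2 * Real.log ‖f x‖ : ℝ)) := by
  simp [interpFamily]

variable {p : ℝ} {f : ℝ → ℂ}

lemma integral_norm_interpFamily_of_re_eq_one (hp : 0 < p) {z : ℂ} (hz : z.re = 1) :
    ∫ x, ‖interpFamily p f z x‖ = ∫ x, ‖f x‖ ^ p := by
  refine integral_congr_ae (.of_forall fun x => ?_)
  simp only
  rw [norm_interpFamily hp f (by rw [hz]; norm_num), hz]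
  ring_nf

lemma integrable_interpFamily_of_re_eq_zero (hp : 0 < p) (hf : Measurable f)
    (hf1 : Integrable fun x => ‖f x‖ ^ (p / 2)) {z : ℂ} (hz : z.re = 0) :
    Integrable (interpFamily p f z) := by
  refine hf1.mono' (measurable_interpFamily hf p z).aestronglyMeasurable (.of_forall fun x => ?_)
  rw [norm_interpFamily hp f hz.ge, hz, add_zero, mul_one]

lemma integrable_interpFamily_of_re_eq_one (hp : 0 < p) (hf : Measurable f)
    (hf2 : Integrable fun x => ‖f x‖ ^ p) {z : ℂ} (hz : z.re = 1) :
    Integrable (interpFamily p f z) := by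
  refine hf2.mono' (measurable_interpFamily hf p z).aestronglyMeasurable (.of_forall fun x => ?_)
  rw [norm_interpFamily hp f (by rw [hz]; norm_num), hz]
  ring_nf
  exact le_rfl

lemma norm_sq_interpFamily_of_re_eq_zero (hp : 0 < p) {z : ℂ} (hz : z.re = 0) (x : ℝ) :
    ‖interpFamily p f z x‖ ^ 2 = ‖f x‖ ^ p := by
  rw [norm_interpFamily hp f hz.ge, hz, add_zero, mul_one, ← Real.rpow_natCast,
    ← Real.rpow_mul (norm_nonneg _)]
  norm_num

lemma memLp_two_interpFamily_of_re_eq_zero (hp : 0 < p) (hf : Measurable f)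
    (hf2 : Integrable fun x => ‖f x‖ ^ p) {z : ℂ} (hz : z.re = 0) :
    MemLp (interpFamily p f z) 2 := by
  rw [memLp_two_iff_integrable_sq_norm (measurable_interpFamily hf p z).aestronglyMeasurable]
  simpa only [norm_sq_interpFamily_of_re_eq_zero hp hz] using hf2

lemma norm_powAmp_le_one_of_zero (b ξ : ℝ) : ‖powAmp 0 b ξ‖ ≤ 1 := by
  rw [powAmp, Complex.norm_exp]
  simp

lemma integrable_of_integrable_norm_rpow {s t : ℝ} (hs : 0 < s) (hs1 : s ≤ 1) (ht : 1 ≤ t)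
    (hf : Measurable f) (hf1 : Integrable fun x => ‖f x‖ ^ s)
    (hf2 : Integrable fun x => ‖f x‖ ^ t) : Integrable f := by
  refine (hf1.add hf2).mono' hf.aestronglyMeasurable (.of_forall fun x => ?_)
  simp only [Pi.add_apply]
  rcases le_total ‖f x‖ 1 with h | h
  · have := Real.rpow_le_rpow_of_exponent_ge' (norm_nonneg _) h hs.le hs1
    rw [Real.rpow_one] at this
    linarith [Real.rpow_nonneg (norm_nonneg (f x)) t]
  · have := Real.rpow_le_rpow_of_exponent_le h ht
    rw [Real.rpow_one] at this
    linarith [Real.rpow_nonneg (norm_nonneg (f x)) s]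

/-- Dispersive estimate in bilinear form on a frequency annulus. -/
lemma norm_setIntegral_freqAnnulus_pairing_le {α θ : ℝ} (hα0 : 0 ≤ α) (hα1 : α ≤ 1)
    (hθ0 : 0 ≤ θ) (hθ1 : θ ≤ 1) (hp : p * (1 + θ) = 2) {g : ℝ → ℂ}
    (hf : Measurable f) (hg : Measurable g)
    (hf1 : Integrable fun x => ‖f x‖ ^ (p / 2)) (hf2 : Integrable fun x => ‖f x‖ ^ p)
    (hg1 : Integrable fun x => ‖g x‖ ^ (p / 2)) (hg2 : Integrable fun x => ‖g x‖ ^ p)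
    {T δ N : ℝ} (hT : T ≠ 0) (hδ : 0 < δ) (hδN : δ ≤ N) :
    ‖∫ ξ in freqAnnulus δ N, (powAmp (α * θ) 0 |ξ| * cexp (I * (T * ξ ^ 4))) *
        (fourierInt f ξ * fourierInt g (-ξ))‖ ≤
      264 * |T| ^ (-(θ * (1 + α) / 4)) * ((∫ x, ‖f x‖ ^ p) * ∫ x, ‖g x‖ ^ p) ^ (1 / p) := by
  have hp0 : 0 < p := pos_of_mul_pos_left (by rw [hp]; norm_num) (by linarith : 0 ≤ 1 + θ)
  set A := freqAnnulus δ N with hA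
  have hAm : MeasurableSet A := measurableSet_freqAnnulus δ N
  set m : ℂ → ℝ → ℂ := fun z ξ =>
    powAmp (α * z.re) (α * z.im) |ξ| * cexp (I * (T * ξ ^ 4)) with hm
  have hA0 : A ⊆ {0}ᶜ := fun ξ hξ h0 => by
    have := (mem_freqAnnulus hδ hξ).1
    rw [h0, abs_zero] at this
    linarith
  have hmi : ∀ z, IntegrableOn (m z) A := fun z => by
    refine ContinuousOn.integrableOn_compact (isCompact_freqAnnulus δ N) ?_
    exact ((continuousOn_powAmp_abs _ _).mono hA0).mul (by fun_prop)
  set c : ℝ × ℝ × ℝ → ℂ :=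
    pairingIntegrand (m 0) (interpFamily p f 0) (interpFamily p g 0) with hc
  set a : ℝ × ℝ × ℝ → ℝ := fun w => α * Real.log |w.1| +
    (p / 2 * Real.log ‖f w.2.1‖ + p / 2 * Real.log ‖g w.2.2‖) with ha
  have hca : ∀ z, (fun w => c w * cexp (z * a w)) =
      pairingIntegrand (m z) (interpFamily p f z) (interpFamily p g z) := fun z => by
    funext w
    have h1 : m z w.1 = m 0 w.1 * cexp (z * (α * Real.log |w.1| : ℝ)) := by
      simp only [hm, powAmp]
      simp only [← Complex.exp_add, zero_re, zero_im, mul_zero]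
      congr 1
      conv_rhs => rw [← re_add_im z]
      push_cast
      ring
    simp only [hc, pairingIntegrand, h1, interpFamily_eq p f z, interpFamily_eq p g z]
    have h2 : cexp (z * a w) = cexp (z * (α * Real.log |w.1| : ℝ)) *
        (cexp (z * (p / 2 * Real.log ‖f w.2.1‖ : ℝ)) *
          cexp (z * (p / 2 * Real.log ‖g w.2.2‖ : ℝ))) := by
      rw [← Complex.exp_add, ← Complex.exp_add]
      congr 1
      simp only [ha]
      push_cast
      ring
    rw [h2]
    ring
  set μ : Measure (ℝ × ℝ × ℝ) := (volume.restrict A).prod (volume.prod volume) with hμ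
  set If := ∫ x, ‖f x‖ ^ p with hIf
  set Ig := ∫ x, ‖g x‖ ^ p with hIg
  have hIf0 : 0 ≤ If := integral_nonneg fun x => by positivity
  have hIg0 : 0 ≤ Ig := integral_nonneg fun x => by positivity
  have key := norm_integral_mul_cexp_le_interp (μ := μ) (c := c) (a := a)
    (A := 2 * Real.pi * (If * Ig) ^ (1 / 2 : ℝ))
    (B := 66 * |T| ^ (-((1 + α) / 4)) * (If * Ig))
    (integrable_pairingIntegrand (hmi 0)
      (integrable_interpFamily_of_re_eq_zero hp0 hf hf1 zero_re)
      (integrable_interpFamily_of_re_eq_zero hp0 hg hg1 zero_re))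
    (by
      have := integrable_pairingIntegrand (hmi 1)
        (integrable_interpFamily_of_re_eq_one hp0 hf hf2 one_re)
        (integrable_interpFamily_of_re_eq_one hp0 hg hg2 one_re)
      rw [← hca 1] at this
      simpa only [one_mul] using this)
    (by fun_prop)
    (fun z hz => by
      have hfi := integrable_interpFamily_of_re_eq_zero hp0 hf hf1 hz
      have hgi := integrable_interpFamily_of_re_eq_zero hp0 hg hg1 hz
      rw [hca, integral_pairingIntegrand (hmi z) hfi hgi]
      refine (norm_setIntegral_mul_fourierInt_le hAm (fun ξ _ => ?_) hfi
        (memLp_two_interpFamily_of_re_eq_zero hp0 hf hf2 hz) hgi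
        (memLp_two_interpFamily_of_re_eq_zero hp0 hg hg2 hz)).trans_eq ?_
      · simp only [hm, hz, mul_zero]
        rw [norm_mul]
        refine mul_le_one₀ (norm_powAmp_le_one_of_zero _ _) (norm_nonneg _) ?_
        rw [mul_comm I, show (T * ξ ^ 4 : ℂ) = ((T * ξ ^ 4 : ℝ) : ℂ) by push_cast; rfl,
          Complex.norm_exp_ofReal_mul_I]
      · simp only [norm_sq_interpFamily_of_re_eq_zero hp0 hz]
        rw [← Real.sqrt_mul hIf0, Real.sqrt_eq_rpow])
    (fun z hz => by
      rw [hca]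
      refine (norm_integral_pairingIntegrand_le (hmi z)
        (integrable_interpFamily_of_re_eq_one hp0 hf hf2 hz)
        (integrable_interpFamily_of_re_eq_one hp0 hg hg2 hz)
        (K := 66 * (1 + |α * z.im|) * |T| ^ (-((1 + α) / 4))) fun x => ?_).trans ?_
      · convert norm_setIntegral_freqAnnulus_le hα0 hα1 (α * z.im) x hT hδ hδN using 4 with ξ
        simp only [hm, hz, mul_one]
        rw [mul_assoc, ← Complex.exp_add]
        congr 2
        ring
      · rw [integral_norm_interpFamily_of_re_eq_one hp0 hz,
          integral_norm_interpFamily_of_re_eq_one hp0 hz]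
        have : |α * z.im| ≤ |z.im| := by
          rw [abs_mul, abs_of_nonneg hα0]
          exact mul_le_of_le_one_left (abs_nonneg _) hα1
        calc _ ≤ 66 * (1 + |z.im|) * |T| ^ (-((1 + α) / 4)) * (If * Ig) := by gcongr
          _ = _ := by ring)
    hθ0 hθ1
  have hp1 : 1 ≤ p := by nlinarith
  have hp2 : p ≤ 2 := by nlinarith
  have hfθ : interpFamily p f θ = f := funext (interpFamily_ofReal hp f)
  have hgθ : interpFamily p g θ = g := funext (interpFamily_ofReal hp g)
  rw [hca, hfθ, hgθ, integral_pairingIntegrand (hmi θ)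
    (integrable_of_integrable_norm_rpow (by positivity) (by linarith) hp1 hf hf1 hf2)
    (integrable_of_integrable_norm_rpow (by positivity) (by linarith) hp1 hg hg1 hg2)] at key
  simp only [hm, ofReal_re, ofReal_im, mul_zero] at key
  refine key.trans ?_
  have hX : 0 ≤ If * Ig := mul_nonneg hIf0 hIg0
  set X := If * Ig
  have hpinv : 1 / p = 1 / 2 * (1 - θ) + θ := by
    rw [div_eq_iff hp0.ne']
    linarith
  have hconst : (2 * Real.pi) ^ (1 - θ) ≤ (132 : ℝ) ^ (1 - θ) :=
    Real.rpow_le_rpow (by positivity) (by linarith [Real.pi_le_four]) (by linarith)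
  rw [hpinv, Real.rpow_add_of_nonneg hX (mul_nonneg (by norm_num) (by linarith)) hθ0,
    Real.rpow_mul hX, Real.mul_rpow (x := 2 * Real.pi) (by positivity) (by positivity),
    show 2 * (66 * |T| ^ (-((1 + α) / 4)) * X) = 132 * (|T| ^ (-((1 + α) / 4)) * X) by ring,
    Real.mul_rpow (x := 132) (by norm_num) (by positivity),
    Real.mul_rpow (by positivity) hX,
    ← Real.rpow_mul (abs_nonneg T), show -((1 + α) / 4) * θ = -(θ * (1 + α) / 4) by ring]
  set Y := (X ^ (1 / 2 : ℝ)) ^ (1 - θ)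
  set Z := |T| ^ (-(θ * (1 + α) / 4))
  have h132 : (132 : ℝ) ^ (1 - θ) * 132 ^ θ = 132 := by
    rw [← Real.rpow_add (by norm_num)]
    norm_num
  calc _ ≤ 2 * ((132 : ℝ) ^ (1 - θ) * Y * (132 ^ θ * (Z * X ^ θ))) := by gcongr
    _ = 2 * ((132 : ℝ) ^ (1 - θ) * 132 ^ θ) * Z * (Y * X ^ θ) := by ring
    _ = _ := by rw [h132]; ring

end Dispersive

section SchwartzSlices

lemma exists_norm_le_decay (F : 𝓢(ℝ × ℝ, ℂ)) : ∃ C : ℝ, 0 ≤ C ∧ ∀ t x : ℝ,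
    ‖F (t, x)‖ ≤ C * (((1 + t ^ 2)⁻¹) ^ 2 * ((1 + x ^ 2)⁻¹) ^ 2) := by
  obtain ⟨C, hC⟩ : ∃ C : ℝ, ∀ z : ℝ × ℝ, (1 + ‖z‖) ^ 8 * ‖F z‖ ≤ C := by
    refine ⟨2 ^ 8 * ((Finset.Iic (8, 0)).sup fun m => SchwartzMap.seminorm ℝ m.1 m.2) F,
      fun z => ?_⟩
    have := SchwartzMap.one_add_le_sup_seminorm_apply (𝕜 := ℝ) (m := (8, 0)) (k := 8) (n := 0)
      le_rfl le_rfl F z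
    rwa [norm_iteratedFDeriv_zero] at this
  refine ⟨C, (by positivity : (0:ℝ) ≤ (1 + ‖(0 : ℝ × ℝ)‖) ^ 8 * ‖F 0‖).trans (hC 0), fun t x => ?_⟩
  have hsq : ∀ s : ℝ, |s| ≤ ‖(t, x)‖ → (1 + s ^ 2) ^ 2 ≤ (1 + ‖(t, x)‖) ^ 4 := fun s hs => by
    have h1 : 1 + s ^ 2 ≤ (1 + ‖(t, x)‖) ^ 2 := by
      rw [← sq_abs]
      nlinarith [abs_nonneg s]
    calc (1 + s ^ 2) ^ 2 ≤ ((1 + ‖(t, x)‖) ^ 2) ^ 2 := by gcongr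
      _ = _ := by ring
  have h1 := hsq t (norm_fst_le (t, x))
  have h2 := hsq x (norm_snd_le (t, x))
  rw [inv_pow, inv_pow, ← mul_inv, ← div_eq_mul_inv, le_div_iff₀ (by positivity)]
  calc ‖F (t, x)‖ * ((1 + t ^ 2) ^ 2 * (1 + x ^ 2) ^ 2)
      ≤ ‖F (t, x)‖ * ((1 + ‖(t, x)‖) ^ 4 * (1 + ‖(t, x)‖) ^ 4) := by gcongr
    _ = (1 + ‖(t, x)‖) ^ 8 * ‖F (t, x)‖ := by ring
    _ ≤ C := hC _

lemma inv_one_add_sq_le_one (t : ℝ) : (1 + t ^ 2)⁻¹ ≤ 1 :=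
  inv_le_one_of_one_le₀ (by nlinarith [sq_nonneg t])

lemma exists_norm_rpow_le_decay (F : 𝓢(ℝ × ℝ, ℂ)) : ∃ C : ℝ, 0 ≤ C ∧ ∀ s : ℝ, 1 / 2 ≤ s →
    ∀ t x : ℝ, ‖F (t, x)‖ ^ s ≤ C ^ s * ((1 + t ^ 2)⁻¹ * (1 + x ^ 2)⁻¹) := by
  obtain ⟨C, hC0, hC⟩ := exists_norm_le_decay F
  refine ⟨C, hC0, fun s hs t x => ?_⟩
  have hz : ∀ t : ℝ, (((1 + t ^ 2)⁻¹) ^ 2) ^ s ≤ (1 + t ^ 2)⁻¹ := fun t => by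
    rw [← Real.rpow_natCast, ← Real.rpow_mul (by positivity)]
    have := Real.rpow_le_rpow_of_exponent_ge (x := (1 + t ^ 2)⁻¹) (y := ((2 : ℕ) : ℝ) * s) (z := 1)
      (by positivity) (inv_one_add_sq_le_one t) (by push_cast; linarith)
    rwa [Real.rpow_one] at this
  calc ‖F (t, x)‖ ^ s ≤ (C * (((1 + t ^ 2)⁻¹) ^ 2 * ((1 + x ^ 2)⁻¹) ^ 2)) ^ s :=
        Real.rpow_le_rpow (norm_nonneg _) (hC t x) (by linarith)
    _ = C ^ s * ((((1 + t ^ 2)⁻¹) ^ 2) ^ s * (((1 + x ^ 2)⁻¹) ^ 2) ^ s) := by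
        rw [Real.mul_rpow hC0 (by positivity), Real.mul_rpow (by positivity) (by positivity)]
    _ ≤ _ := by
        gcongr
        · exact hz t
        · exact hz x

variable (F : 𝓢(ℝ × ℝ, ℂ))

lemma integrable_norm_rpow_slice {s : ℝ} (hs : 1 / 2 ≤ s) (t : ℝ) :
    Integrable fun x => ‖F (t, x)‖ ^ s := by
  obtain ⟨C, hC0, hC⟩ := exists_norm_rpow_le_decay F
  refine (integrable_inv_one_add_sq.const_mul (C ^ s * (1 + t ^ 2)⁻¹)).mono' ?_
    (.of_forall fun x => ?_)
  · have : Continuous fun x => F (t, x) := F.continuous.comp (by fun_prop)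
    exact (this.norm.rpow_const fun _ => Or.inr (by linarith)).aestronglyMeasurable
  · rw [Real.norm_of_nonneg (by positivity)]
    exact (hC s hs t x).trans_eq (by ring)

lemma exists_norm_le_inv_mul_inv : ∃ C : ℝ, 0 ≤ C ∧ ∀ t x : ℝ,
    ‖F (t, x)‖ ≤ C * ((1 + t ^ 2)⁻¹ * (1 + x ^ 2)⁻¹) := by
  obtain ⟨C, hC0, hC⟩ := exists_norm_rpow_le_decay F
  refine ⟨C, hC0, fun t x => ?_⟩
  simpa using hC 1 (by norm_num) t x

lemma integrable_slice (t : ℝ) : Integrable fun x => F (t, x) := by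
  have : Continuous fun x => F (t, x) := F.continuous.comp (by fun_prop)
  rw [← integrable_norm_iff this.aestronglyMeasurable]
  simpa using integrable_norm_rpow_slice F (s := 1) (by norm_num) t

/-- The spatial Fourier transform of `F (t, ·)`. -/
noncomputable def sliceFourier (t ξ : ℝ) : ℂ := fourierInt (fun y => F (t, y)) ξ

lemma continuous_sliceFourier : Continuous fun z : ℝ × ℝ => sliceFourier F z.1 z.2 := by
  obtain ⟨C, hC0, hC⟩ := exists_norm_le_inv_mul_inv F
  refine continuous_of_dominated (bound := fun x => C * (1 + x ^ 2)⁻¹)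
    (fun z => ?_) (fun z => .of_forall fun x => ?_) (integrable_inv_one_add_sq.const_mul C)
    (.of_forall fun x => ?_)
  · exact (by fun_prop : Continuous fun x : ℝ =>
      cexp (-(I * x * z.2)) * F (z.1, x)).aestronglyMeasurable
  · rw [norm_mul, norm_cexp_neg_I_mul, one_mul]
    refine (hC _ _).trans ?_
    gcongr
    exact mul_le_of_le_one_left (by positivity) (inv_one_add_sq_le_one _)
  · fun_prop

lemma exists_norm_sliceFourier_le : ∃ C : ℝ, 0 ≤ C ∧ ∀ t ξ : ℝ,
    ‖sliceFourier F t ξ‖ ≤ C * (1 + t ^ 2)⁻¹ := by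
  obtain ⟨C, hC0, hC⟩ := exists_norm_le_inv_mul_inv F
  refine ⟨C * Real.pi, by positivity, fun t ξ => ?_⟩
  have := norm_integral_le_of_norm_le (f := fun x : ℝ => cexp (-(I * x * ξ)) * F (t, x))
    (integrable_inv_one_add_sq.const_mul (C * (1 + t ^ 2)⁻¹)) (.of_forall fun x => by
      rw [norm_mul, norm_cexp_neg_I_mul, one_mul]
      exact (hC t x).trans_eq (by ring))
  rw [integral_const_mul, integral_univ_inv_one_add_sq] at this
  exact this.trans_eq (by ring)

lemma conj_sliceFourier (t ξ : ℝ) :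
    (starRingEnd ℂ) (sliceFourier F t ξ) =
      fourierInt (fun y => (starRingEnd ℂ) (F (t, y))) (-ξ) := by
  rw [sliceFourier, fourierInt, ← integral_conj, fourierInt]
  refine integral_congr_ae (.of_forall fun x => ?_)
  simp [← Complex.exp_conj]

/-- The Fourier transform of `∫ e^{-it∂_x⁴} F(t) dt`. -/
noncomputable def dualFourier (ξ : ℝ) : ℂ := ∫ t : ℝ, cexp (-(I * (t * ξ ^ 4))) * sliceFourier F t ξ

lemma norm_cexp_neg_I_quartic (t ξ : ℝ) : ‖cexp (-(I * (t * ξ ^ 4)))‖ = 1 := by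
  rw [show -(I * (t * ξ ^ 4) : ℂ) = ((-(t * ξ ^ 4) : ℝ) : ℂ) * I by push_cast; ring,
    Complex.norm_exp_ofReal_mul_I]

lemma integrable_dualFourier_integrand (ξ : ℝ) :
    Integrable fun t : ℝ => cexp (-(I * (t * ξ ^ 4))) * sliceFourier F t ξ := by
  obtain ⟨C, hC0, hC⟩ := exists_norm_sliceFourier_le F
  refine (integrable_inv_one_add_sq.const_mul C).mono' ?_ (.of_forall fun t => ?_)
  · have := (continuous_sliceFourier F).comp (by fun_prop : Continuous fun t : ℝ => (t, ξ))
    exact (Continuous.mul (by fun_prop) this).aestronglyMeasurable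
  · rw [norm_mul, norm_cexp_neg_I_quartic, one_mul]
    exact hC t ξ

lemma continuous_dualFourier : Continuous (dualFourier F) := by
  obtain ⟨C, hC0, hC⟩ := exists_norm_sliceFourier_le F
  refine continuous_of_dominated (fun ξ => (integrable_dualFourier_integrand F ξ).1)
    (bound := fun t => C * (1 + t ^ 2)⁻¹) (fun ξ => .of_forall fun t => ?_)
    (integrable_inv_one_add_sq.const_mul C) (.of_forall fun t => ?_)
  · rw [norm_mul, norm_cexp_neg_I_quartic, one_mul]
    exact hC t ξ
  · have := (continuous_sliceFourier F).comp (by fun_prop : Continuous fun ξ : ℝ => (t, ξ))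
    exact Continuous.mul (by fun_prop) this

/-- The `L^p` norm of `F (t, ·)`. -/
noncomputable def sliceNorm (p t : ℝ) : ℝ := (∫ x, ‖F (t, x)‖ ^ p) ^ (1 / p)

lemma sliceNorm_nonneg (p t : ℝ) : 0 ≤ sliceNorm F p t :=
  Real.rpow_nonneg (integral_nonneg fun x => by positivity) _

lemma measurable_sliceNorm (p : ℝ) : Measurable (sliceNorm F p) := by
  have h : Measurable fun z : ℝ × ℝ => ‖F z‖ ^ p := by
    have := F.continuous.measurable
    fun_prop
  have h2 : StronglyMeasurable fun t => ∫ x, ‖F (t, x)‖ ^ p :=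
    h.stronglyMeasurable.integral_prod_right
  exact h2.measurable.pow_const _

end SchwartzSlices

section SpaceTime

variable (F : 𝓢(ℝ × ℝ, ℂ))

lemma powAmp_abs_of_ne_zero (a : ℝ) {ξ : ℝ} (hξ : ξ ≠ 0) :
    powAmp a 0 |ξ| = ((|ξ| ^ a : ℝ) : ℂ) := by
  rw [powAmp, Real.rpow_def_of_pos (abs_pos.2 hξ)]
  push_cast
  congr 1
  ring

lemma integrable_dualFourier_kernel {A : Set ℝ} {k : ℝ → ℂ} (hk : IntegrableOn k A) :
    Integrable (fun w : ℝ × ℝ × ℝ => k w.1 *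
      ((cexp (-(I * (w.2.1 * w.1 ^ 4))) * sliceFourier F w.2.1 w.1) *
        (starRingEnd ℂ) (cexp (-(I * (w.2.2 * w.1 ^ 4))) * sliceFourier F w.2.2 w.1)))
      ((volume.restrict A).prod (volume.prod volume)) := by
  obtain ⟨C, hC0, hC⟩ := exists_norm_sliceFourier_le F
  have hI := integrable_inv_one_add_sq.const_mul C
  refine (Integrable.mul_prod hk.norm (hI.mul_prod hI)).mono' ?_ (.of_forall fun w => ?_)
  · have h1 := (continuous_sliceFourier F).comp
      (by fun_prop : Continuous fun w : ℝ × ℝ × ℝ => (w.2.1, w.1))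
    have h2 := (continuous_sliceFourier F).comp
      (by fun_prop : Continuous fun w : ℝ × ℝ × ℝ => (w.2.2, w.1))
    refine (AEStronglyMeasurable.comp_fst (ν := volume.prod volume) hk.1).mul
      (Continuous.aestronglyMeasurable ?_)
    exact (Continuous.mul (by fun_prop) h1).mul
      (Complex.continuous_conj.comp (Continuous.mul (by fun_prop) h2))
  · simp only [norm_mul, RCLike.norm_conj, norm_cexp_neg_I_quartic, one_mul]
    gcongr
    · exact hC _ _
    · exact hC _ _

lemma norm_setIntegral_kernel_slices_le {α θ p : ℝ} (hα0 : 0 ≤ α) (hα1 : α ≤ 1)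
    (hθ0 : 0 ≤ θ) (hθ1 : θ ≤ 1) (hp : p * (1 + θ) = 2) {δ N : ℝ} (hδ : 0 < δ) (hδN : δ ≤ N)
    {t s : ℝ} (hts : s ≠ t) :
    ‖∫ ξ in freqAnnulus δ N, powAmp (α * θ) 0 |ξ| *
      ((cexp (-(I * (t * ξ ^ 4))) * sliceFourier F t ξ) *
        (starRingEnd ℂ) (cexp (-(I * (s * ξ ^ 4))) * sliceFourier F s ξ))‖ ≤
      264 * (sliceNorm F p t * sliceNorm F p s * |t - s| ^ (-(θ * (1 + α) / 4))) := by
  have hp1 : 1 ≤ p := by nlinarith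
  have hm : ∀ t, Measurable fun x => F (t, x) := fun t =>
    (F.continuous.comp (by fun_prop : Continuous fun x : ℝ => (t, x))).measurable
  have hconj : ∀ x, ‖(starRingEnd ℂ) (F (s, x))‖ = ‖F (s, x)‖ := fun x => RCLike.norm_conj _
  have key := norm_setIntegral_freqAnnulus_pairing_le hα0 hα1 hθ0 hθ1 hp (hm t)
    (Complex.continuous_conj.measurable.comp (hm s))
    (integrable_norm_rpow_slice F (by linarith) t) (integrable_norm_rpow_slice F (by linarith) t)
    (by simpa only [Function.comp_apply, hconj] using
      integrable_norm_rpow_slice F (s := p / 2) (by linarith) s)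
    (by simpa only [Function.comp_apply, hconj] using
      integrable_norm_rpow_slice F (s := p) (by linarith) s)
    (sub_ne_zero.2 hts) hδ hδN
  simp only [Function.comp_apply, hconj] at key
  rw [Real.mul_rpow (integral_nonneg fun x => by positivity)
    (integral_nonneg fun x => by positivity), abs_sub_comm] at key
  refine (le_of_eq ?_).trans (key.trans_eq ?_)
  · congr 1
    refine integral_congr_ae (.of_forall fun ξ => ?_)
    simp only
    have he : cexp (I * ((s - t : ℝ) * ξ ^ 4)) =
        cexp (-(I * (t * ξ ^ 4))) * (starRingEnd ℂ) (cexp (-(I * (s * ξ ^ 4)))) := by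
      rw [← Complex.exp_conj, ← Complex.exp_add]
      congr 1
      simp only [map_neg, map_mul, conj_I, conj_ofReal, map_pow]
      push_cast
      ring
    rw [he, map_mul, conj_sliceFourier, sliceFourier, Function.comp_def]
    ring
  · simp only [sliceNorm]
    ring

lemma setLIntegral_freqAnnulus_dualFourier_le {α θ p : ℝ} (hα0 : 0 ≤ α) (hα1 : α ≤ 1)
    (hθ0 : 0 ≤ θ) (hθ1 : θ ≤ 1) (hp : p * (1 + θ) = 2) {δ N : ℝ} (hδ : 0 < δ) (hδN : δ ≤ N) :
    ∫⁻ ξ in freqAnnulus δ N, ENNReal.ofReal (|ξ| ^ (α * θ)) * ‖dualFourier F ξ‖ₑ ^ 2 ≤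
      264 * ∫⁻ t, ∫⁻ s, ENNReal.ofReal (sliceNorm F p t) * ENNReal.ofReal (sliceNorm F p s) *
        ENNReal.ofReal (|t - s| ^ (-(θ * (1 + α) / 4))) := by
  set A := freqAnnulus δ N with hA
  have hAm : MeasurableSet A := measurableSet_freqAnnulus δ N
  have hA0 : A ⊆ {0}ᶜ := fun ξ hξ h0 => by
    have := (mem_freqAnnulus hδ hξ).1
    rw [h0, abs_zero] at this
    linarith
  have hk : IntegrableOn (fun ξ => powAmp (α * θ) 0 |ξ|) A :=
    ((continuousOn_powAmp_abs _ _).mono hA0).integrableOn_compact (isCompact_freqAnnulus δ N)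
  set J : ℝ × ℝ × ℝ → ℂ := fun w => powAmp (α * θ) 0 |w.1| *
      ((cexp (-(I * (w.2.1 * w.1 ^ 4))) * sliceFourier F w.2.1 w.1) *
        (starRingEnd ℂ) (cexp (-(I * (w.2.2 * w.1 ^ 4))) * sliceFourier F w.2.2 w.1)) with hJ
  have hJi : Integrable J ((volume.restrict A).prod (volume.prod volume)) :=
    integrable_dualFourier_kernel F hk
  have hinner : ∀ ξ, ∫ w : ℝ × ℝ, J (ξ, w) =
      powAmp (α * θ) 0 |ξ| * (dualFourier F ξ * (starRingEnd ℂ) (dualFourier F ξ)) := fun ξ => by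
    simp only [hJ, dualFourier]
    rw [integral_const_mul, ← integral_conj, ← integral_prod_mul, Measure.volume_eq_prod]
  have hsq : ∀ ξ, powAmp (α * θ) 0 |ξ| * (dualFourier F ξ * (starRingEnd ℂ) (dualFourier F ξ)) =
      powAmp (α * θ) 0 |ξ| * ((‖dualFourier F ξ‖ ^ 2 : ℝ) : ℂ) := fun ξ => by
    rw [Complex.mul_conj, Complex.normSq_eq_norm_sq]
  have hcont := continuous_dualFourier F
  have hint : IntegrableOn (fun ξ => |ξ| ^ (α * θ) * ‖dualFourier F ξ‖ ^ 2) A := by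
    refine ContinuousOn.integrableOn_compact (isCompact_freqAnnulus δ N) ?_
    refine ContinuousOn.mul (fun ξ hξ => ?_) (by fun_prop)
    exact (continuous_abs.continuousAt.rpow_const
      (Or.inl (abs_ne_zero.2 (hA0 hξ)))).continuousWithinAt
  have e1 : ∫⁻ ξ in A, ENNReal.ofReal (|ξ| ^ (α * θ)) * ‖dualFourier F ξ‖ₑ ^ 2 =
      ‖∫ w, J w ∂((volume.restrict A).prod (volume.prod volume))‖ₑ := by
    have e2 : ∫ w, J w ∂((volume.restrict A).prod (volume.prod volume)) =
        ((∫ ξ in A, |ξ| ^ (α * θ) * ‖dualFourier F ξ‖ ^ 2 : ℝ) : ℂ) := by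
      rw [integral_prod _ hJi, ← integral_complex_ofReal]
      refine setIntegral_congr_fun hAm fun ξ hξ => ?_
      rw [← Measure.volume_eq_prod, hinner, hsq, powAmp_abs_of_ne_zero _ (hA0 hξ), ofReal_mul]
    rw [e2, ← ofReal_norm, Complex.norm_real, Real.norm_of_nonneg (integral_nonneg fun ξ => by
      positivity), ofReal_integral_eq_lintegral_ofReal hint (.of_forall fun ξ => by positivity)]
    refine lintegral_congr fun ξ => ?_
    rw [ENNReal.ofReal_mul (by positivity), ENNReal.ofReal_pow (norm_nonneg _), ofReal_norm]
  rw [e1, integral_prod_symm _ hJi, integral_prod _ hJi.integral_prod_right]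
  refine (enorm_integral_le_lintegral_enorm _).trans ?_
  rw [← lintegral_const_mul' _ _ (by norm_num)]
  refine lintegral_mono fun t => ?_
  refine (enorm_integral_le_lintegral_enorm _).trans ?_
  rw [← lintegral_const_mul' _ _ (by norm_num)]
  refine lintegral_mono_ae ?_
  filter_upwards [(Set.countable_singleton t).ae_notMem volume] with s hs
  have := norm_setIntegral_kernel_slices_le F hα0 hα1 hθ0 hθ1 hp hδ hδN
    (show s ≠ t from hs)
  rw [← ofReal_norm]
  refine (ENNReal.ofReal_le_ofReal this).trans_eq ?_
  rw [ENNReal.ofReal_mul (by norm_num), ENNReal.ofReal_mul (mul_nonneg (sliceNorm_nonneg F p t)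
    (sliceNorm_nonneg F p s)), ENNReal.ofReal_mul (sliceNorm_nonneg F p t)]
  norm_num

lemma monotone_freqAnnulus_inv : Monotone fun n : ℕ => freqAnnulus ((n : ℝ) + 1)⁻¹ (n + 1) := by
  intro m n hmn
  have h1 : (m : ℝ) ≤ n := by exact_mod_cast hmn
  have h2 : ((n : ℝ) + 1)⁻¹ ≤ ((m : ℝ) + 1)⁻¹ := by gcongr
  exact Set.union_subset_union (Set.Icc_subset_Icc h2 (by linarith))
    (Set.Icc_subset_Icc (by linarith) (by linarith))

lemma iUnion_freqAnnulus_inv : ⋃ n : ℕ, freqAnnulus ((n : ℝ) + 1)⁻¹ (n + 1) = {0}ᶜ := by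
  ext ξ
  rw [Set.mem_iUnion, Set.mem_compl_singleton_iff]
  constructor
  · rintro ⟨n, hn⟩ rfl
    have := (mem_freqAnnulus (by positivity) hn).1
    rw [abs_zero] at this
    exact absurd this (not_le.2 (by positivity))
  · intro hξ
    obtain ⟨n, hn⟩ := exists_nat_ge (max |ξ| |ξ|⁻¹)
    have h0 : 0 < |ξ| := abs_pos.2 hξ
    have h1 : |ξ| ≤ n + 1 := by linarith [le_max_left |ξ| |ξ|⁻¹]
    have h2 : ((n : ℝ) + 1)⁻¹ ≤ |ξ| :=
      inv_le_of_inv_le₀ h0 (by linarith [le_max_right |ξ| |ξ|⁻¹])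
    refine ⟨n, ?_⟩
    rcases le_total 0 ξ with h | h
    · rw [abs_of_nonneg h] at h1 h2
      exact Or.inl (Set.mem_Icc.2 ⟨h2, h1⟩)
    · rw [abs_of_nonpos h] at h1 h2
      exact Or.inr (Set.mem_Icc.2 ⟨by linarith, by linarith⟩)

lemma lintegral_dualFourier_le {α θ p : ℝ} (hα0 : 0 ≤ α) (hα1 : α ≤ 1)
    (hθ0 : 0 ≤ θ) (hθ1 : θ ≤ 1) (hp : p * (1 + θ) = 2) :
    ∫⁻ ξ, ENNReal.ofReal (|ξ| ^ (α * θ)) * ‖dualFourier F ξ‖ₑ ^ 2 ≤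
      264 * ∫⁻ t, ∫⁻ s, ENNReal.ofReal (sliceNorm F p t) * ENNReal.ofReal (sliceNorm F p s) *
        ENNReal.ofReal (|t - s| ^ (-(θ * (1 + α) / 4))) := by
  have h0 : (({0}ᶜ : Set ℝ)) =ᵐ[volume] (Set.univ : Set ℝ) := by
    rw [ae_eq_univ]
    simp
  rw [← setLIntegral_univ, ← setLIntegral_congr h0, ← iUnion_freqAnnulus_inv,
    setLIntegral_iUnion_of_directed _ monotone_freqAnnulus_inv.directed_le]
  refine iSup_le fun n => setLIntegral_freqAnnulus_dualFourier_le F hα0 hα1 hθ0 hθ1 hp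
    (by positivity) ?_
  exact (inv_le_one_of_one_le₀ (by linarith [Nat.cast_nonneg (α := ℝ) n])).trans
    (by linarith [Nat.cast_nonneg (α := ℝ) n])

/-- Weighted `L²` bound for `dualFourier` by the mixed norm, in the Fourier variable. -/
lemma exists_lintegral_dualFourier_le {α θ p κ : ℝ} (hα0 : 0 ≤ α) (hα1 : α ≤ 1)
    (hθ0 : 0 ≤ θ) (hθ1 : θ ≤ 1) (hp : p * (1 + θ) = 2) (hκ : κ * (2 - θ * (1 + α) / 4) = 2) :
    ∃ C : ℝ, 0 ≤ C ∧ ∀ F : 𝓢(ℝ × ℝ, ℂ),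
      ∫⁻ ξ, ENNReal.ofReal (|ξ| ^ (α * θ)) * ‖dualFourier F ξ‖ₑ ^ 2 ≤
        ENNReal.ofReal C * (∫⁻ t, ENNReal.ofReal (sliceNorm F p t) ^ κ) ^ (2 / κ) := by
  set l := θ * (1 + α) / 4 with hl
  have hl0 : 0 ≤ l := by positivity
  have hl1 : l < 1 := by nlinarith
  have hκ1 : 2 / (2 - l) = κ := by rw [div_eq_iff (by linarith)]; exact hκ.symm
  have hκ2 : 2 - l = 2 / κ := by
    have : κ ≠ 0 := fun h => by rw [h] at hκ; norm_num at hκ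
    rw [eq_div_iff this, mul_comm]
    exact hκ
  rcases hl0.eq_or_lt with h | h
  · have hκ' : κ = 1 := by rw [← h] at hκ; linarith
    refine ⟨264, by norm_num, fun F => (lintegral_dualFourier_le F hα0 hα1 hθ0 hθ1 hp).trans ?_⟩
    rw [← hl, ← h, hκ', ENNReal.ofReal_ofNat]
    gcongr
    simp only [neg_zero, Real.rpow_zero, ENNReal.ofReal_one, mul_one, ENNReal.rpow_one, div_one]
    rw [ENNReal.rpow_two, sq, ← lintegral_mul_const _ (measurable_sliceNorm F p).ennreal_ofReal]
    refine lintegral_mono fun t => ?_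
    rw [lintegral_const_mul _ (measurable_sliceNorm F p).ennreal_ofReal]
  · refine ⟨264 * (2 * ((2 / (1 - l) + 1) * (2 - l) / l)), ?_, fun F =>
      (lintegral_dualFourier_le F hα0 hα1 hθ0 hθ1 hp).trans ?_⟩
    · have : 0 < 1 - l := by linarith
      have : 0 < 2 - l := by linarith
      positivity
    · rw [ENNReal.ofReal_mul (by norm_num), mul_assoc, ENNReal.ofReal_ofNat, ← hκ1]
      gcongr
      have := lintegral_lintegral_mul_abs_rpow_neg_le h hl1 (measurable_sliceNorm F p)
        (sliceNorm_nonneg F p)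
      rwa [show 2 / (2 / (2 - l)) = 2 - l by rw [hκ1, ← hκ2]]

end SpaceTime

section FrequencyDecay

open LineDeriv

lemma hasDerivAt_slice (F : 𝓢(ℝ × ℝ, ℂ)) (t x : ℝ) :
    HasDerivAt (fun y => F (t, y)) ((∂_{((0 : ℝ), (1 : ℝ))} F) (t, x)) x := by
  rw [SchwartzMap.lineDerivOp_apply_eq_fderiv]
  exact F.differentiableAt.hasFDerivAt.comp_hasDerivAt x
    ((hasDerivAt_const x t).prodMk (hasDerivAt_id x))

lemma sliceFourier_lineDeriv (F : 𝓢(ℝ × ℝ, ℂ)) (t ξ : ℝ) :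
    sliceFourier (∂_{((0 : ℝ), (1 : ℝ))} F) t ξ = I * ξ * sliceFourier F t ξ := by
  have hd : deriv (fun y => F (t, y)) = fun x => (∂_{((0 : ℝ), (1 : ℝ))} F) (t, x) :=
    funext fun x => (hasDerivAt_slice F t x).deriv
  have key := Real.fourier_deriv (integrable_slice F t)
    (fun x => (hasDerivAt_slice F t x).differentiableAt)
    (by rw [hd]; exact integrable_slice _ t)
  rw [hd] at key
  rw [sliceFourier, sliceFourier, fourierInt_eq, fourierInt_eq, key]
  have : (Real.pi : ℂ) ≠ 0 := by exact_mod_cast Real.pi_ne_zero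
  simp only [smul_eq_mul]
  push_cast
  field_simp

lemma sliceFourier_sub (F H : 𝓢(ℝ × ℝ, ℂ)) (t ξ : ℝ) :
    sliceFourier (F - H) t ξ = sliceFourier F t ξ - sliceFourier H t ξ := by
  have h : ∀ F : 𝓢(ℝ × ℝ, ℂ), Integrable fun x : ℝ => cexp (-(I * x * ξ)) * F (t, x) := fun F =>
    (integrable_slice F t).bdd_mul (c := 1) (by fun_prop)
      (.of_forall fun x => (norm_cexp_neg_I_mul x ξ).le)
  rw [sliceFourier, sliceFourier, sliceFourier, fourierInt, fourierInt, fourierInt,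
    ← integral_sub (h F) (h H)]
  refine integral_congr_ae (.of_forall fun x => ?_)
  simp only [sub_apply]
  ring

lemma sliceFourier_one_sub_lineDeriv (F : 𝓢(ℝ × ℝ, ℂ)) (t ξ : ℝ) :
    sliceFourier (F - ∂_{((0 : ℝ), (1 : ℝ))} (∂_{((0 : ℝ), (1 : ℝ))} F)) t ξ =
      ((1 + ξ ^ 2 : ℝ) : ℂ) * sliceFourier F t ξ := by
  rw [sliceFourier_sub, sliceFourier_lineDeriv, sliceFourier_lineDeriv]
  push_cast
  linear_combination (-ξ ^ 2 * sliceFourier F t ξ : ℂ) * I_mul_I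

lemma exists_norm_sliceFourier_le_decay (F : 𝓢(ℝ × ℝ, ℂ)) : ∃ C : ℝ, 0 ≤ C ∧ ∀ t ξ : ℝ,
    ‖sliceFourier F t ξ‖ ≤ C * (1 + t ^ 2)⁻¹ * ((1 + ξ ^ 2)⁻¹) ^ 2 := by
  set L : 𝓢(ℝ × ℝ, ℂ) → 𝓢(ℝ × ℝ, ℂ) := fun F =>
    F - ∂_{((0 : ℝ), (1 : ℝ))} (∂_{((0 : ℝ), (1 : ℝ))} F) with hL
  obtain ⟨C, hC0, hC⟩ := exists_norm_sliceFourier_le (L (L F))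
  refine ⟨C, hC0, fun t ξ => ?_⟩
  have := hC t ξ
  rw [hL, sliceFourier_one_sub_lineDeriv, sliceFourier_one_sub_lineDeriv, norm_mul, norm_mul,
    Complex.norm_real, Real.norm_of_nonneg (by positivity)] at this
  rw [inv_pow, ← div_eq_mul_inv, le_div_iff₀ (by positivity)]
  linarith

end FrequencyDecay

section DualGroup

variable (F : 𝓢(ℝ × ℝ, ℂ)) {β : ℝ}

lemma abs_rpow_mul_inv_sq_le (h0 : 0 ≤ β) (h1 : β ≤ 1) (ξ : ℝ) :
    |ξ| ^ β * ((1 + ξ ^ 2)⁻¹) ^ 2 ≤ 2 * (1 + ξ ^ 2)⁻¹ := by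
  have hle : |ξ| ^ β ≤ 2 * (1 + ξ ^ 2) := by
    have h2 : |ξ| ^ β ≤ 1 + |ξ| := by
      rcases le_total |ξ| 1 with h | h
      · linarith [Real.rpow_le_one (abs_nonneg ξ) h h0, abs_nonneg ξ]
      · have := Real.rpow_le_rpow_of_exponent_le h h1
        rw [Real.rpow_one] at this
        linarith
    have := sq_abs ξ
    nlinarith [sq_nonneg (|ξ| - 1)]
  calc |ξ| ^ β * ((1 + ξ ^ 2)⁻¹) ^ 2 ≤ 2 * (1 + ξ ^ 2) * ((1 + ξ ^ 2)⁻¹) ^ 2 := by gcongr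
    _ = 2 * (1 + ξ ^ 2)⁻¹ := by field_simp

lemma integral_DbihamGroup_neg_eq (h0 : 0 ≤ β) (h1 : β ≤ 1) (x : ℝ) :
    ∫ t : ℝ, DbihamGroup β (-t) (fun y => F (t, y)) x =
      ((2 * Real.pi)⁻¹ : ℝ) * fourierInt (fun ξ => ((|ξ| ^ β : ℝ) : ℂ) * dualFourier F ξ) (-x) := by
  obtain ⟨C, hC0, hC⟩ := exists_norm_sliceFourier_le_decay F
  have hnorm : ∀ t ξ : ℝ, ‖cexp (I * (x * ξ + (-t : ℝ) * ξ ^ 4))‖ = 1 := fun t ξ => by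
    rw [show I * (x * ξ + (-t : ℝ) * ξ ^ 4) = ((x * ξ + -t * ξ ^ 4 : ℝ) : ℂ) * I by
      push_cast; ring, Complex.norm_exp_ofReal_mul_I]
  have hint : Integrable (fun w : ℝ × ℝ => ((|w.2| ^ β : ℝ) : ℂ) *
      cexp (I * (x * w.2 + (-w.1 : ℝ) * w.2 ^ 4)) * sliceFourier F w.1 w.2)
      (volume.prod volume) := by
    refine ((integrable_inv_one_add_sq.const_mul C).mul_prod
      (integrable_inv_one_add_sq.const_mul 2)).mono' ?_ (.of_forall fun w => ?_)
    · have hr : Continuous fun w : ℝ × ℝ => |w.2| ^ β :=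
        (continuous_snd.abs).rpow_const fun _ => Or.inr h0
      exact (((continuous_ofReal.comp hr).mul (by fun_prop)).mul
        (continuous_sliceFourier F)).aestronglyMeasurable
    · rw [norm_mul, norm_mul, hnorm, mul_one, Complex.norm_real,
        Real.norm_of_nonneg (by positivity)]
      calc |w.2| ^ β * ‖sliceFourier F w.1 w.2‖
          ≤ |w.2| ^ β * (C * (1 + w.1 ^ 2)⁻¹ * ((1 + w.2 ^ 2)⁻¹) ^ 2) := by
            gcongr
            exact hC _ _
        _ = C * (1 + w.1 ^ 2)⁻¹ * (|w.2| ^ β * ((1 + w.2 ^ 2)⁻¹) ^ 2) := by ring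
        _ ≤ _ := mul_le_mul_of_nonneg_left (abs_rpow_mul_inv_sq_le h0 h1 _) (by positivity)
  have e : ∀ t, DbihamGroup β (-t) (fun y => F (t, y)) x = ((2 * Real.pi)⁻¹ : ℝ) *
      ∫ ξ : ℝ, ((|ξ| ^ β : ℝ) : ℂ) * cexp (I * (x * ξ + (-t : ℝ) * ξ ^ 4)) *
        sliceFourier F t ξ := fun t => by
    rw [DbihamGroup]
    push_cast
    rfl
  simp_rw [e]
  rw [integral_const_mul, integral_integral_swap hint, fourierInt]
  congr 1
  refine integral_congr_ae (.of_forall fun ξ => ?_)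
  simp only [dualFourier]
  rw [← integral_const_mul, ← integral_const_mul]
  refine integral_congr_ae (.of_forall fun t => ?_)
  simp only
  have : cexp (I * (x * ξ + (-t : ℝ) * ξ ^ 4)) =
      cexp (-(I * ξ * (-x : ℝ))) * cexp (-(I * (t * ξ ^ 4))) := by
    rw [← Complex.exp_add]
    congr 1
    push_cast
    ring
  rw [this]
  ring

lemma exists_norm_dualFourier_le : ∃ C : ℝ, 0 ≤ C ∧ ∀ ξ : ℝ,
    ‖dualFourier F ξ‖ ≤ C * ((1 + ξ ^ 2)⁻¹) ^ 2 := by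
  obtain ⟨C, hC0, hC⟩ := exists_norm_sliceFourier_le_decay F
  refine ⟨C * Real.pi, by positivity, fun ξ => ?_⟩
  have := norm_integral_le_of_norm_le
    (f := fun t : ℝ => cexp (-(I * (t * ξ ^ 4))) * sliceFourier F t ξ)
    (integrable_inv_one_add_sq.const_mul (C * ((1 + ξ ^ 2)⁻¹) ^ 2)) (.of_forall fun t => by
      rw [norm_mul, norm_cexp_neg_I_quartic, one_mul]
      exact (hC t ξ).trans_eq (by ring))
  rw [integral_const_mul, integral_univ_inv_one_add_sq] at this
  exact this.trans_eq (by ring)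

lemma eLpNorm_integral_DbihamGroup_neg (h0 : 0 ≤ β) (h1 : β ≤ 1) :
    eLpNorm (fun x => ∫ t : ℝ, DbihamGroup β (-t) (fun y => F (t, y)) x) 2 volume =
      ENNReal.ofReal (2 * Real.pi)⁻¹ * (ENNReal.ofReal (2 * Real.pi) ^ (1 / 2 : ℝ) *
        (∫⁻ ξ, ENNReal.ofReal (|ξ| ^ (2 * β)) * ‖dualFourier F ξ‖ₑ ^ 2) ^ (1 / 2 : ℝ)) := by
  obtain ⟨C, hC0, hC⟩ := exists_norm_dualFourier_le F
  set g : ℝ → ℂ := fun ξ => ((|ξ| ^ β : ℝ) : ℂ) * dualFourier F ξ with hg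
  have hgc : Continuous g := by
    have hr : Continuous fun ξ : ℝ => |ξ| ^ β := continuous_abs.rpow_const fun _ => Or.inr h0
    exact (continuous_ofReal.comp hr).mul (continuous_dualFourier F)
  have hgb : ∀ ξ, ‖g ξ‖ ≤ 2 * C * (1 + ξ ^ 2)⁻¹ := fun ξ => by
    rw [hg, norm_mul, Complex.norm_real, Real.norm_of_nonneg (by positivity)]
    calc |ξ| ^ β * ‖dualFourier F ξ‖ ≤ |ξ| ^ β * (C * ((1 + ξ ^ 2)⁻¹) ^ 2) := by
          gcongr
          exact hC ξ
      _ = C * (|ξ| ^ β * ((1 + ξ ^ 2)⁻¹) ^ 2) := by ring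
      _ ≤ C * (2 * (1 + ξ ^ 2)⁻¹) :=
          mul_le_mul_of_nonneg_left (abs_rpow_mul_inv_sq_le h0 h1 ξ) hC0
      _ = _ := by ring
  have hgi : Integrable g :=
    (integrable_inv_one_add_sq.const_mul (2 * C)).mono' hgc.aestronglyMeasurable (.of_forall hgb)
  have hg2 : MemLp g 2 := by
    rw [memLp_two_iff_integrable_sq_norm hgc.aestronglyMeasurable]
    refine (integrable_inv_one_add_sq.const_mul ((2 * C) ^ 2)).mono'
      (by fun_prop) (.of_forall fun ξ => ?_)
    rw [Real.norm_of_nonneg (by positivity)]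
    calc ‖g ξ‖ ^ 2 ≤ (2 * C * (1 + ξ ^ 2)⁻¹) ^ 2 := by
          gcongr
          exact hgb ξ
      _ = (2 * C) ^ 2 * ((1 + ξ ^ 2)⁻¹ * (1 + ξ ^ 2)⁻¹) := by ring
      _ ≤ (2 * C) ^ 2 * (1 + ξ ^ 2)⁻¹ := by
          gcongr
          exact mul_le_of_le_one_left (by positivity) (inv_one_add_sq_le_one ξ)
  have hD : (fun x => ∫ t : ℝ, DbihamGroup β (-t) (fun y => F (t, y)) x) =
      (((2 * Real.pi)⁻¹ : ℝ) : ℂ) • fun x => fourierInt g (-x) :=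
    funext fun x => integral_DbihamGroup_neg_eq F h0 h1 x
  have hneg : eLpNorm (fun x => fourierInt g (-x)) 2 volume = eLpNorm (fourierInt g) 2 volume :=
    eLpNorm_comp_measurePreserving (continuous_fourierInt hgi).aestronglyMeasurable
      (Measure.measurePreserving_neg volume)
  have hsq : (∫⁻ ξ, ENNReal.ofReal (|ξ| ^ (2 * β)) * ‖dualFourier F ξ‖ₑ ^ 2) =
      eLpNorm g 2 volume ^ 2 := by
    rw [← lintegral_enorm_sq_eq]
    refine lintegral_congr fun ξ => ?_
    rw [hg, enorm_mul, mul_pow, ← ofReal_norm ((|ξ| ^ β : ℝ) : ℂ), Complex.norm_real,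
      Real.norm_of_nonneg (by positivity), ← ENNReal.ofReal_pow (by positivity),
      ← Real.rpow_mul_natCast (abs_nonneg ξ)]
    norm_num [mul_comm]
  rw [hD, eLpNorm_const_smul, hneg, eLpNorm_fourierInt_eq hgi hg2, hsq, ← ENNReal.rpow_natCast,
    ← ENNReal.rpow_mul, ← ofReal_norm, Complex.norm_real, Real.norm_of_nonneg (by positivity)]
  norm_num

end DualGroup

section Main

lemma toReal_eLpNorm_slice (F : 𝓢(ℝ × ℝ, ℂ)) {r : ℝ≥0∞} (hr0 : r ≠ 0) (hr : r ≠ ∞)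
    (hr1 : 1 / 2 ≤ r.toReal) (t : ℝ) :
    (eLpNorm (fun x => F (t, x)) r volume).toReal = sliceNorm F r.toReal t := by
  have hmem : MemLp (fun x => F (t, x)) r volume :=
    (integrable_norm_rpow_iff (integrable_slice F t).1 hr0 hr).1
      (integrable_norm_rpow_slice F hr1 t)
  rw [hmem.eLpNorm_eq_integral_rpow_norm hr0 hr, ENNReal.toReal_ofReal
    (Real.rpow_nonneg (integral_nonneg fun x => by positivity) _), sliceNorm, one_div]

lemma mixedNorm_eq (F : 𝓢(ℝ × ℝ, ℂ)) {q r : ℝ≥0∞} (hq0 : q ≠ 0) (hq : q ≠ ∞) (hr0 : r ≠ 0)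
    (hr : r ≠ ∞) (hr1 : 1 / 2 ≤ r.toReal) :
    mixedNorm q r (fun t x => F (t, x)) =
      (∫⁻ t, ENNReal.ofReal (sliceNorm F r.toReal t) ^ q.toReal) ^ (1 / q.toReal) := by
  rw [mixedNorm, eLpNorm_eq_lintegral_rpow_enorm_toReal hq0 hq]
  congr 1
  refine lintegral_congr fun t => ?_
  rw [toReal_eLpNorm_slice F hr0 hr hr1, Real.enorm_of_nonneg (sliceNorm_nonneg F _ t)]

lemma inv_toReal_add_inv_toReal {a b : ℝ≥0∞} (h : 1 / a + 1 / b = 1) :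
    a.toReal⁻¹ + b.toReal⁻¹ = 1 := by
  have ha : 1 / a ≠ ∞ := fun h' => by simp [h'] at h
  have hb : 1 / b ≠ ∞ := fun h' => by simp [h'] at h
  have := congrArg ENNReal.toReal h
  rw [ENNReal.toReal_add ha hb] at this
  simpa using this

end Main

end Strichartz

/-- Dual homogeneous Strichartz estimate:
`‖∫ D^{(α/2)(1-2/r)} e^{-it'∂_x⁴} F(t') dt'‖_{L²} ≤ C ‖F‖_{L_t^{q'} L_x^{r'}}`. -/
theorem stmt_5 (q r : ℝ≥0∞) (α : ℝ) (h : Admissible q r α)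
    (q' r' : ℝ≥0∞) (hq' : 1/q + 1/q' = 1) (hr' : 1/r + 1/r' = 1) :
    ∃ C > (0:ℝ), ∀ F : SchwartzMap (ℝ × ℝ) ℂ,
      eLpNorm (fun x : ℝ =>
          ∫ t' : ℝ, DbihamGroup ((α/2) * (1 - 2/r.toReal)) (-t') (fun y => F (t', y)) x)
          2 volume ≤
        ENNReal.ofReal C * mixedNorm q' r' (fun t x => F (t, x)) := by
  obtain ⟨⟨hα0, hα1⟩, hr2, -, hadm⟩ := h
  have hρ := inv_toReal_add_inv_toReal hr'
  have hσ := inv_toReal_add_inv_toReal hq'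
  have hadm' : 4 * q.toReal⁻¹ + (1 + α) * r.toReal⁻¹ = (1 + α) / 2 := by
    have h1 : 4 / q ≠ ∞ := fun h' => by simp [h'] at hadm
    have h2 : ENNReal.ofReal (1 + α) / r ≠ ∞ := fun h' => by simp [h'] at hadm
    have := congrArg ENNReal.toReal hadm
    rw [ENNReal.toReal_add h1 h2, ENNReal.toReal_div, ENNReal.toReal_div,
      ENNReal.toReal_ofReal (by linarith), ENNReal.toReal_ofReal (by linarith)] at this
    simpa [div_eq_mul_inv] using this
  have hρ2 : r.toReal⁻¹ ≤ 1 / 2 := by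
    rcases eq_or_ne r ∞ with rfl | hr
    · simp
    · have := ENNReal.toReal_mono hr hr2
      rw [one_div]
      exact inv_anti₀ (by norm_num) this
  have hρ0 : 0 ≤ r.toReal⁻¹ := by positivity
  set θ := 1 - 2 / r.toReal with hθ
  have hθρ : θ = 1 - 2 * r.toReal⁻¹ := by rw [hθ, div_eq_mul_inv]
  set p := r'.toReal with hp
  set κ := q'.toReal with hκ
  have hp0 : 0 < p := inv_pos.1 (by linarith)
  have hθ0 : 0 ≤ θ := by linarith
  have hθ1 : θ ≤ 1 := by linarith
  have hκ0 : 0 < κ := inv_pos.1 (by nlinarith)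
  have hpθ : p * (1 + θ) = 2 := by
    have : 1 + θ = 2 * p⁻¹ := by linarith
    rw [this]
    field_simp
  have hκl : κ * (2 - θ * (1 + α) / 4) = 2 := by
    have : 2 - θ * (1 + α) / 4 = 2 * κ⁻¹ := by rw [hθρ]; linarith
    rw [this]
    field_simp
  obtain ⟨C, hC0, hC⟩ := exists_lintegral_dualFourier_le hα0 hα1 hθ0 hθ1 hpθ hκl
  have hr'0 : r' ≠ 0 ∧ r' ≠ ∞ := ENNReal.toReal_pos_iff.1 hp0 |>.imp ne_of_gt ne_of_lt
  have hq'0 : q' ≠ 0 ∧ q' ≠ ∞ := ENNReal.toReal_pos_iff.1 hκ0 |>.imp ne_of_gt ne_of_lt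
  refine ⟨(2 * Real.pi)⁻¹ * ((2 * Real.pi) ^ (1 / 2 : ℝ) * (C ^ (1 / 2 : ℝ))) + 1, by positivity,
    fun F => ?_⟩
  rw [eLpNorm_integral_DbihamGroup_neg F (by positivity) (by nlinarith),
    mixedNorm_eq F hq'0.1 hq'0.2 hr'0.1 hr'0.2 (by nlinarith),
    show 2 * (α / 2 * θ) = α * θ by ring]
  set X := ∫⁻ t, ENNReal.ofReal (sliceNorm F p t) ^ κ with hX
  have hmono := ENNReal.rpow_le_rpow (hC F) (by norm_num : (0 : ℝ) ≤ 1 / 2)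
  rw [ENNReal.mul_rpow_of_nonneg _ _ (by norm_num), ← ENNReal.rpow_mul,
    show 2 / κ * (1 / 2) = 1 / κ by ring, ENNReal.ofReal_rpow_of_nonneg hC0 (by norm_num)] at hmono
  calc _ ≤ ENNReal.ofReal (2 * Real.pi)⁻¹ * (ENNReal.ofReal (2 * Real.pi) ^ (1 / 2 : ℝ) *
        (ENNReal.ofReal (C ^ (1 / 2 : ℝ)) * X ^ (1 / κ))) := by gcongr
    _ = ENNReal.ofReal ((2 * Real.pi)⁻¹ * ((2 * Real.pi) ^ (1 / 2 : ℝ) * (C ^ (1 / 2 : ℝ)))) *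
        X ^ (1 / κ) := by
      rw [ENNReal.ofReal_rpow_of_nonneg (by positivity) (by norm_num),
        ENNReal.ofReal_mul (by positivity),
        ENNReal.ofReal_mul (p := (2 * Real.pi) ^ (1 / 2 : ℝ)) (by positivity)]
      ring
    _ ≤ _ := by
      gcongr
      linarith
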